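/- arXiv:1705.05292 — 2 statements merged into one kernel-verified Lean document; each statement's English description precedes it below -/
import Mathlib

section
/- Let (X,T) be a TDS, μ ∈ M_T(X) and β a finite Borel partition of X. For every M ∈ ℕ and every ε > 0 there exists δ > 0 such that for every pair of Borel covers U = {U_1,...,U_M} and V = {V_1,...,V_M} of X with μ(U Δ V) < δ one has |h^+_μ(U|β,T) - h^+_μ(V|β,T)| ≤ ε. -/
open MeasureTheory Real Filter

namespace Paper

variable {X : Type*} [MeasurableSpace X]

/-- `𝒰` is a finite cover of `X` (a finite family of sets whose union is `X`). -/
def IsCover (𝒰 : Finset (Set X)) : Prop :=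
  ⋃₀ (𝒰 : Set (Set X)) = Set.univ

/-- `𝒰` is a partition of `X`: a cover by pairwise disjoint sets. -/
def IsPartition (𝒰 : Finset (Set X)) : Prop :=
  IsCover 𝒰 ∧ ∀ A ∈ 𝒰, ∀ B ∈ 𝒰, A ≠ B → Disjoint A B

/-- All members of `𝒰` are measurable (Borel) sets. -/
def MeasF (𝒰 : Finset (Set X)) : Prop := ∀ A ∈ 𝒰, MeasurableSet A

/-- `𝒰 ≽ 𝒱` : every element of `𝒰` is contained in some element of `𝒱`. -/
def Refines (𝒰 𝒱 : Finset (Set X)) : Prop := ∀ A ∈ 𝒰, ∃ B ∈ 𝒱, A ⊆ B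

/-- The join `𝒰 ∨ 𝒱 = {U ∩ V : U ∈ 𝒰, V ∈ 𝒱}`. -/
noncomputable def join (𝒰 𝒱 : Finset (Set X)) : Finset (Set X) :=
  letI := Classical.decEq (Set X)
  (𝒰 ×ˢ 𝒱).image fun p => p.1 ∩ p.2

/-- The preimage cover `f⁻¹𝒰 = {f⁻¹U : U ∈ 𝒰}`. -/
noncomputable def pre {Y : Type*} (f : X → Y) (𝒰 : Finset (Set Y)) : Finset (Set X) :=
  letI := Classical.decEq (Set X)
  𝒰.image fun U => f ⁻¹' U

/-- `dynJoin f 𝒰 N = 𝒰_0^{N-1} = ⋁_{n=0}^{N-1} f^{-n} 𝒰` (equal to `{univ}` for `N = 0`). -/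
noncomputable def dynJoin (f : X → X) (𝒰 : Finset (Set X)) : ℕ → Finset (Set X)
  | 0 => {Set.univ}
  | (N + 1) => join (dynJoin f 𝒰 N) (pre (f^[N]) 𝒰)

/-- `N(𝒰 ∩ B)`: the minimal cardinality of a subfamily of `𝒰` whose union contains `B`. -/
noncomputable def covNum (𝒰 : Finset (Set X)) (B : Set X) : ℕ :=
  sInf {k : ℕ | ∃ 𝒱 ⊆ 𝒰, 𝒱.card = k ∧ B ⊆ ⋃₀ (𝒱 : Set (Set X))}

/-- `N(𝒰|β) = max_{B ∈ β} N(𝒰 ∩ B)`. -/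
noncomputable def covNumCond (𝒰 β : Finset (Set X)) : ℕ :=
  β.sup fun B => covNum 𝒰 B

/-- The entropy `H_μ(α) = -∑_{A ∈ α} μ(A) log μ(A)` of a finite family of sets. -/
noncomputable def entPart (μ : Measure X) (α : Finset (Set X)) : ℝ :=
  ∑ A ∈ α, negMulLog (μ A).toReal

/-- Conditional entropy `H_μ(α|β) = ∑_{B ∈ β} μ(B) H_{μ_B}(α)`, where `μ_B` is the
conditional measure (which is `0` when `μ(B) = 0`). -/
noncomputable def entCondPart (μ : Measure X) (α β : Finset (Set X)) : ℝ :=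
  ∑ B ∈ β, (μ B).toReal * entPart (ProbabilityTheory.cond μ B) α

/-- `H_μ(𝒰) = inf { H_μ(α) : α a measurable partition finer than 𝒰 }`. -/
noncomputable def covEnt (μ : Measure X) (𝒰 : Finset (Set X)) : ℝ :=
  sInf {h : ℝ | ∃ α : Finset (Set X),
    IsPartition α ∧ MeasF α ∧ Refines α 𝒰 ∧ h = entPart μ α}

/-- `H_μ(𝒰|β) = ∑_{B ∈ β} μ(B) H_{μ_B}(𝒰)` for a cover `𝒰` and a partition `β`. -/
noncomputable def covEntCond (μ : Measure X) (𝒰 β : Finset (Set X)) : ℝ :=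
  ∑ B ∈ β, (μ B).toReal * covEnt (ProbabilityTheory.cond μ B) 𝒰

/-- `h_μ(α|β,f) = lim_N (1/N) H_μ(α_0^{N-1}|β_0^{N-1})`; by subadditivity the limit
equals the infimum. -/
noncomputable def hPart (f : X → X) (μ : Measure X) (α β : Finset (Set X)) : ℝ :=
  ⨅ N : ℕ, entCondPart μ (dynJoin f α (N + 1)) (dynJoin f β (N + 1)) / (N + 1 : ℝ)

/-- `h_μ^-(𝒰|β,f) = lim_N (1/N) H_μ(𝒰_0^{N-1}|β_0^{N-1})`; by subadditivity the limit
equals the infimum. -/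
noncomputable def hMinus (f : X → X) (μ : Measure X) (𝒰 β : Finset (Set X)) : ℝ :=
  ⨅ N : ℕ, covEntCond μ (dynJoin f 𝒰 (N + 1)) (dynJoin f β (N + 1)) / (N + 1 : ℝ)

/-- `h_μ^+(𝒰|β,f) = inf { h_μ(α|β,f) : α a measurable partition finer than 𝒰 }`. -/
noncomputable def hPlus (f : X → X) (μ : Measure X) (𝒰 β : Finset (Set X)) : ℝ :=
  sInf {h : ℝ | ∃ α : Finset (Set X),
    IsPartition α ∧ MeasF α ∧ Refines α 𝒰 ∧ h = hPart f μ α β}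

/-- The (combinatorial/topological) conditional entropy
`h(𝒰|β,f) = lim_N (1/N) log N(𝒰_0^{N-1}|β_0^{N-1})`; by subadditivity the limit
equals the infimum. -/
noncomputable def hTop (f : X → X) (𝒰 β : Finset (Set X)) : ℝ :=
  ⨅ N : ℕ, Real.log (covNumCond (dynJoin f 𝒰 (N + 1)) (dynJoin f β (N + 1))) / (N + 1 : ℝ)

/-- The finite family of sets associated to an indexed cover `{U_1, …, U_M}`. -/
noncomputable def rangeFinset {M : ℕ} (U : Fin M → Set X) : Finset (Set X) :=
  letI := Classical.decEq (Set X)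
  Finset.image U Finset.univ

end Paper

open Paper MeasureTheory Real Filter

namespace Paper

section FiberEntropy

variable {X : Type*} {S S' W : Type*}

/-- The function `f` parametrises the family `α`: its members are, up to the empty set, exactly
the fibres of `f`. -/
def Represents (f : X → S) (α : Finset (Set X)) : Prop :=
  (∀ x, f ⁻¹' {f x} ∈ α) ∧ ∀ A ∈ α, ∀ x ∈ A, A = f ⁻¹' {f x}

lemma Represents.sum_eq [Fintype S] {f : X → S} {α : Finset (Set X)} (h : Represents f α)
    (F : Set X → ℝ) (hF : F ∅ = 0) : ∑ A ∈ α, F A = ∑ s, F (f ⁻¹' {s}) := by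
  classical
  have h1 : ∑ s, F (f ⁻¹' {s}) =
      ∑ s ∈ Finset.univ.filter (fun s => (f ⁻¹' {s}).Nonempty), F (f ⁻¹' {s}) := by
    symm
    apply Finset.sum_filter_of_ne
    intro s _ hs
    by_contra hne
    rw [Set.not_nonempty_iff_eq_empty] at hne
    exact hs (by rw [hne, hF])
  have h2 : ∑ s ∈ Finset.univ.filter (fun s => (f ⁻¹' {s}).Nonempty), F (f ⁻¹' {s}) =
      ∑ A ∈ (Finset.univ.filter (fun s => (f ⁻¹' {s}).Nonempty)).image
        (fun s => f ⁻¹' {s}), F A := by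
    symm
    apply Finset.sum_image
    intro s hs t _ hst
    obtain ⟨x, hx⟩ := (Finset.mem_filter.1 hs).2
    have hx' : x ∈ f ⁻¹' {t} := by
      have : f ⁻¹' {s} = f ⁻¹' {t} := hst
      rwa [this] at hx
    exact hx.symm.trans hx'
  rw [h1, h2]
  symm
  apply Finset.sum_subset
  · intro A hA
    simp only [Finset.mem_image, Finset.mem_filter, Finset.mem_univ, true_and] at hA
    obtain ⟨s, ⟨x, rfl⟩, rfl⟩ := hA
    exact h.1 x
  · intro A hA hA'
    have : A = ∅ := by
      by_contra hne
      obtain ⟨x, hx⟩ := Set.nonempty_iff_ne_empty.2 hne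
      apply hA'
      simp only [Finset.mem_image, Finset.mem_filter, Finset.mem_univ, true_and]
      exact ⟨f x, ⟨x, rfl⟩, (h.2 A hA x hx).symm⟩
    rw [this, hF]

/-- The finite family of fibres of a function to a finite type. -/
noncomputable def fiberFamily [Fintype S] (f : X → S) : Finset (Set X) :=
  letI := Classical.decEq (Set X)
  Finset.univ.image fun s => f ⁻¹' {s}

lemma mem_fiberFamily [Fintype S] {f : X → S} {A : Set X} :
    A ∈ fiberFamily f ↔ ∃ s, f ⁻¹' {s} = A := by
  simp [fiberFamily]

lemma represents_fiberFamily [Fintype S] (f : X → S) : Represents f (fiberFamily f) := by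
  refine ⟨fun x => mem_fiberFamily.2 ⟨f x, rfl⟩, fun A hA x hx => ?_⟩
  obtain ⟨s, rfl⟩ := mem_fiberFamily.1 hA
  rw [show f x = s from hx]

lemma isPartition_fiberFamily [Fintype S] (f : X → S) : IsPartition (fiberFamily f) := by
  refine ⟨Set.eq_univ_of_forall fun x => ⟨_, mem_fiberFamily.2 ⟨f x, rfl⟩, rfl⟩, ?_⟩
  intro A hA B hB hAB
  obtain ⟨s, rfl⟩ := mem_fiberFamily.1 hA
  obtain ⟨t, rfl⟩ := mem_fiberFamily.1 hB
  rw [Set.disjoint_left]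
  intro x hx hx'
  exact hAB (by rw [← show f x = s from hx, ← show f x = t from hx'])

lemma Represents.of_ker {f : X → S} {g : X → S'} {α : Finset (Set X)} (h : Represents f α)
    (hfg : ∀ x y, f x = f y ↔ g x = g y) : Represents g α := by
  have key : ∀ x, g ⁻¹' {g x} = f ⁻¹' {f x} := fun x => by
    ext y; exact (hfg y x).symm
  exact ⟨fun x => by rw [key]; exact h.1 x, fun A hA x hx => by rw [key]; exact h.2 A hA x hx⟩

lemma Represents.join {f : X → S} {g : X → S'} {α β : Finset (Set X)} (hf : Represents f α)
    (hg : Represents g β) : Represents (fun x => (f x, g x)) (join α β) := by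
  have key : ∀ x, (fun x => (f x, g x)) ⁻¹' {(f x, g x)} = f ⁻¹' {f x} ∩ g ⁻¹' {g x} :=
    fun x => by ext y; simp
  constructor
  · intro x
    simp only [Paper.join, Finset.mem_image, Finset.mem_product, Prod.exists]
    exact ⟨_, _, ⟨hf.1 x, hg.1 x⟩, (key x).symm⟩
  · intro A hA x hx
    simp only [Paper.join, Finset.mem_image, Finset.mem_product, Prod.exists] at hA
    obtain ⟨a, b, ⟨ha, hb⟩, rfl⟩ := hA
    rw [key, ← hf.2 a ha x hx.1, ← hg.2 b hb x hx.2]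

lemma Represents.pre {f : X → S} {α : Finset (Set X)} (hf : Represents f α) (T : X → X) :
    Represents (fun x => f (T x)) (pre T α) := by
  constructor
  · intro x
    simp only [Paper.pre, Finset.mem_image]
    exact ⟨_, hf.1 (T x), rfl⟩
  · intro A hA x hx
    simp only [Paper.pre, Finset.mem_image] at hA
    obtain ⟨a, ha, rfl⟩ := hA
    rw [hf.2 a ha (T x) hx]
    rfl

/-- The itinerary of length `N` of a point under `T`, observed through `f`. -/
def itinerary (T : X → X) (f : X → S) (N : ℕ) (x : X) : Fin N → S := fun i => f (T^[i] x)

lemma itinerary_succ_eq_iff (T : X → X) (f : X → S) (N : ℕ) (x y : X) :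
    itinerary T f (N + 1) x = itinerary T f (N + 1) y ↔
      itinerary T f N x = itinerary T f N y ∧ f (T^[N] x) = f (T^[N] y) := by
  simp [funext_iff, itinerary, Fin.forall_fin_succ']

lemma Represents.dynJoin {f : X → S} {α : Finset (Set X)} (hf : Represents f α) (T : X → X)
    (N : ℕ) : Represents (itinerary T f N) (dynJoin T α N) := by
  induction N with
  | zero =>
    have key : ∀ x, itinerary T f 0 ⁻¹' {itinerary T f 0 x} = Set.univ := fun x => by
      ext y; simp [eq_iff_true_of_subsingleton]
    exact ⟨fun x => by simp [Paper.dynJoin, key], fun A hA x _ => by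
      rw [key]; simpa [Paper.dynJoin] using hA⟩
  | succ N ih =>
    refine (ih.join (hf.pre T^[N])).of_ker fun x y => ?_
    rw [itinerary_succ_eq_iff, Prod.mk.injEq]

lemma IsPartition.exists_represents {α : Finset (Set X)} (hα : IsPartition α) :
    ∃ f : X → α, Represents f α ∧ ∀ A, ∀ x, x ∈ f ⁻¹' {A} ↔ x ∈ A.1 := by
  have hc : ∀ x, ∃ A : α, x ∈ A.1 := fun x => by
    obtain ⟨A, hA, hx⟩ : x ∈ ⋃₀ (α : Set (Set X)) := by
      rw [show ⋃₀ (α : Set (Set X)) = Set.univ from hα.1]; trivial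
    exact ⟨⟨A, hA⟩, hx⟩
  choose f hf using hc
  have key : ∀ A : α, ∀ x, x ∈ A.1 → f x = A := fun A x hx => by
    by_contra hne
    exact Set.disjoint_left.1 (hα.2 _ (f x).2 _ A.2 fun h => hne (Subtype.ext h)) (hf x) hx
  have key' : ∀ A, ∀ x, x ∈ f ⁻¹' {A} ↔ x ∈ A.1 := fun A x =>
    ⟨fun h => by rw [← show f x = A from h]; exact hf x, fun h => key A x h⟩
  refine ⟨f, ⟨fun x => ?_, fun A hA x hx => ?_⟩, key'⟩
  · rw [show f ⁻¹' {f x} = (f x).1 from Set.ext (key' _)]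
    exact (f x).2
  · rw [key ⟨A, hA⟩ x hx]
    exact (Set.ext (key' ⟨A, hA⟩)).symm

lemma pair_preimage (f : X → S) (g : X → S') (p : S × S') :
    (fun x => (f x, g x)) ⁻¹' {p} = f ⁻¹' {p.1} ∩ g ⁻¹' {p.2} := by
  ext x; simp [Prod.ext_iff]

variable [MeasurableSpace X]

/-- All fibres of `f` are measurable. -/
def MeasFibers (f : X → S) : Prop := ∀ s, MeasurableSet (f ⁻¹' {s})

lemma MeasFibers.pair {f : X → S} {g : X → S'} (hf : MeasFibers f) (hg : MeasFibers g) :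
    MeasFibers fun x => (f x, g x) := fun p => by
  rw [pair_preimage]; exact (hf _).inter (hg _)

lemma MeasFibers.comp {f : X → S} (hf : MeasFibers f) {T : X → X} (hT : Measurable T) :
    MeasFibers fun x => f (T x) := fun s => hT (hf s)

lemma MeasFibers.itinerary {f : X → S} (hf : MeasFibers f) {T : X → X} (hT : Measurable T)
    (N : ℕ) : MeasFibers (Paper.itinerary T f N) := fun s => by
  have : Paper.itinerary T f N ⁻¹' {s} = ⋂ i : Fin N, (fun x => f (T^[i] x)) ⁻¹' {s i} := by
    ext x; simp [Paper.itinerary, funext_iff]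
  rw [this]
  exact MeasurableSet.iInter fun i => hf.comp (hT.iterate i) (s i)

lemma MeasFibers.preimage [Finite S] {f : X → S} (hf : MeasFibers f) (s : Set S) :
    MeasurableSet (f ⁻¹' s) := by
  rw [← Set.biUnion_preimage_singleton]
  exact MeasurableSet.biUnion s.toFinite.countable fun i _ => hf i

lemma MeasFibers.map [Finite S] {f : X → S} (hf : MeasFibers f) (φ : S → S') :
    MeasFibers fun x => φ (f x) := fun t => hf.preimage (φ ⁻¹' {t})

variable (μ : Measure X)

/-- The Shannon entropy of the partition into fibres of `f`. -/
noncomputable def fiberEntropy [Fintype S] (f : X → S) : ℝ :=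
  ∑ s, negMulLog (μ.real (f ⁻¹' {s}))

lemma fiberEntropy_congr [Fintype S] [Fintype S'] {f : X → S} {g : X → S'}
    (hfg : ∀ x y, f x = f y ↔ g x = g y) : fiberEntropy μ f = fiberEntropy μ g := by
  have h := represents_fiberFamily f
  have h0 : negMulLog (μ.real ∅) = 0 := by simp
  rw [fiberEntropy, fiberEntropy, ← h.sum_eq (fun A => negMulLog (μ.real A)) h0,
    ← (h.of_ker hfg).sum_eq (fun A => negMulLog (μ.real A)) h0]

lemma fiberEntropy_pair [Fintype S] [Fintype S'] (f : X → S) (g : X → S') :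
    fiberEntropy μ (fun x => (f x, g x)) =
      ∑ s, ∑ t, negMulLog (μ.real (f ⁻¹' {s} ∩ g ⁻¹' {t})) := by
  simp only [fiberEntropy, pair_preimage, Fintype.sum_prod_type]

lemma fiberEntropy_comp [Fintype S] {f : X → S} (hf : MeasFibers f) {T : X → X}
    (hT : MeasurePreserving T μ μ) :
    fiberEntropy μ (fun x => f (T x)) = fiberEntropy μ f := by
  refine Finset.sum_congr rfl fun s _ => ?_
  rw [← hT.measureReal_preimage (hf s).nullMeasurableSet]
  rfl

lemma entCondPart_nonneg (α β : Finset (Set X)) : 0 ≤ entCondPart μ α β := by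
  refine Finset.sum_nonneg fun B _ => mul_nonneg ENNReal.toReal_nonneg
    (Finset.sum_nonneg fun A _ => negMulLog_nonneg ENNReal.toReal_nonneg ?_)
  exact ENNReal.toReal_le_of_le_ofReal zero_le_one (by simpa using prob_le_one)

lemma hPart_nonneg (T : X → X) (α β : Finset (Set X)) : 0 ≤ hPart T μ α β :=
  Real.iInf_nonneg fun _ => div_nonneg (entCondPart_nonneg μ _ _) (by positivity)

variable [IsProbabilityMeasure μ]

lemma sum_measureReal_inter_fiber [Fintype S] {f : X → S} (hf : MeasFibers f) (E : Set X) :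
    ∑ s, μ.real (E ∩ f ⁻¹' {s}) = μ.real E := by
  have := sum_measureReal_preimage_singleton (μ := μ.restrict E) (f := f) Finset.univ
    (fun s _ => hf s)
  simpa [measureReal_restrict_apply (hf _), Set.inter_comm] using this

lemma sum_measureReal_fiber_inter [Fintype S] {f : X → S} (hf : MeasFibers f) (E : Set X) :
    ∑ s, μ.real (f ⁻¹' {s} ∩ E) = μ.real E := by
  simpa only [Set.inter_comm] using sum_measureReal_inter_fiber μ hf E

lemma fiberEntropy_pair_sub [Fintype S] [Fintype S'] {f : X → S} (hf : MeasFibers f)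
    (g : X → S') : fiberEntropy μ (fun x => (f x, g x)) - fiberEntropy μ g =
      ∑ t, ∑ s, μ.real (f ⁻¹' {s} ∩ g ⁻¹' {t}) *
        (log (μ.real (g ⁻¹' {t})) - log (μ.real (f ⁻¹' {s} ∩ g ⁻¹' {t}))) := by
  rw [fiberEntropy_pair, Finset.sum_comm, fiberEntropy, ← Finset.sum_sub_distrib]
  refine Finset.sum_congr rfl fun t _ => ?_
  simp only [mul_sub, Finset.sum_sub_distrib, ← Finset.sum_mul]
  rw [sum_measureReal_fiber_inter μ hf]
  simp only [negMulLog, neg_mul, Finset.sum_neg_distrib]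
  ring

lemma fiberEntropy_mono [Fintype S] [Fintype S'] {f : X → S} {g : X → S'}
    (hf : MeasFibers f) (hfg : ∀ x y, f x = f y → g x = g y) :
    fiberEntropy μ g ≤ fiberEntropy μ f := by
  have h1 : fiberEntropy μ f = fiberEntropy μ (fun x => (f x, g x)) :=
    fiberEntropy_congr μ fun x y => by
      simp only [Prod.mk.injEq]
      exact ⟨fun h => ⟨h, hfg x y h⟩, fun h => h.1⟩
  rw [h1, ← sub_nonneg, fiberEntropy_pair_sub μ hf g]
  refine Finset.sum_nonneg fun t _ => Finset.sum_nonneg fun s _ => ?_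
  have hle : μ.real (f ⁻¹' {s} ∩ g ⁻¹' {t}) ≤ μ.real (g ⁻¹' {t}) :=
    measureReal_mono Set.inter_subset_right
  rcases (measureReal_nonneg (μ := μ) (s := f ⁻¹' {s} ∩ g ⁻¹' {t})).eq_or_lt with h | h
  · rw [← h, zero_mul]
  · exact mul_nonneg h.le (sub_nonneg.2 (Real.log_le_log h hle))

lemma mul_log_sub_log_le {a b c d : ℝ} (ha : 0 ≤ a) (hab : a ≤ b) (hac : a ≤ c) (hbd : b ≤ d) :
    a * ((log b - log a) + (log c - log d)) ≤ b * c / d - a := by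
  rcases ha.eq_or_lt with rfl | ha
  · simp only [zero_mul, sub_zero]
    exact div_nonneg (mul_nonneg hab hac) (hab.trans hbd)
  have hb := ha.trans_le hab
  have hc := ha.trans_le hac
  have hd := hb.trans_le hbd
  have hlog : (log b - log a) + (log c - log d) = log (b * c / (a * d)) := by
    rw [log_div (by positivity) (by positivity), log_mul hb.ne' hc.ne', log_mul ha.ne' hd.ne']
    ring
  rw [hlog]
  calc a * log (b * c / (a * d)) ≤ a * (b * c / (a * d) - 1) :=
        mul_le_mul_of_nonneg_left (log_le_sub_one_of_pos (by positivity)) ha.le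
    _ = b * c / d - a := by field_simp

lemma fiberEntropy_submodular [Fintype S] [Fintype S'] [Fintype W] {f : X → S} {g : X → S'}
    (hf : MeasFibers f) (hg : MeasFibers g) (h : X → W) :
    fiberEntropy μ (fun x => (f x, g x, h x)) + fiberEntropy μ h ≤
      fiberEntropy μ (fun x => (f x, h x)) + fiberEntropy μ (fun x => (g x, h x)) := by
  have e1 : fiberEntropy μ (fun x => (f x, g x, h x)) =
      -∑ w, ∑ t, ∑ s, μ.real (f ⁻¹' {s} ∩ (g ⁻¹' {t} ∩ h ⁻¹' {w})) *
        log (μ.real (f ⁻¹' {s} ∩ (g ⁻¹' {t} ∩ h ⁻¹' {w}))) := by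
    simp only [fiberEntropy_pair, Fintype.sum_prod_type, pair_preimage, negMulLog, neg_mul,
      Finset.sum_neg_distrib]
    rw [Finset.sum_comm]
    simp_rw [Finset.sum_comm (s := (Finset.univ : Finset S)) (t := (Finset.univ : Finset W))]
    rw [Finset.sum_comm]
  have e2 : fiberEntropy μ (fun x => (f x, h x)) =
      -∑ w, ∑ t, ∑ s, μ.real (f ⁻¹' {s} ∩ (g ⁻¹' {t} ∩ h ⁻¹' {w})) *
        log (μ.real (f ⁻¹' {s} ∩ h ⁻¹' {w})) := by
    rw [fiberEntropy_pair, Finset.sum_comm, ← Finset.sum_neg_distrib]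
    refine Finset.sum_congr rfl fun w _ => ?_
    rw [Finset.sum_comm, ← Finset.sum_neg_distrib]
    refine Finset.sum_congr rfl fun s _ => ?_
    rw [← Finset.sum_mul]
    simp only [Set.inter_left_comm (f ⁻¹' {s})]
    rw [sum_measureReal_fiber_inter μ hg, negMulLog, neg_mul]
  have e3 : fiberEntropy μ (fun x => (g x, h x)) =
      -∑ w, ∑ t, ∑ s, μ.real (f ⁻¹' {s} ∩ (g ⁻¹' {t} ∩ h ⁻¹' {w})) *
        log (μ.real (g ⁻¹' {t} ∩ h ⁻¹' {w})) := by
    rw [fiberEntropy_pair, Finset.sum_comm, ← Finset.sum_neg_distrib]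
    refine Finset.sum_congr rfl fun w _ => ?_
    rw [← Finset.sum_neg_distrib]
    refine Finset.sum_congr rfl fun t _ => ?_
    rw [← Finset.sum_mul, sum_measureReal_fiber_inter μ hf, negMulLog, neg_mul]
  have e4 : fiberEntropy μ h =
      -∑ w, ∑ t, ∑ s, μ.real (f ⁻¹' {s} ∩ (g ⁻¹' {t} ∩ h ⁻¹' {w})) *
        log (μ.real (h ⁻¹' {w})) := by
    rw [fiberEntropy, ← Finset.sum_neg_distrib]
    refine Finset.sum_congr rfl fun w _ => ?_
    simp only [← Finset.sum_mul, sum_measureReal_fiber_inter μ hf,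
      sum_measureReal_fiber_inter μ hg, negMulLog, neg_mul]
  have key : ∑ w, ∑ t, ∑ s, μ.real (f ⁻¹' {s} ∩ (g ⁻¹' {t} ∩ h ⁻¹' {w})) *
      ((log (μ.real (f ⁻¹' {s} ∩ h ⁻¹' {w})) -
          log (μ.real (f ⁻¹' {s} ∩ (g ⁻¹' {t} ∩ h ⁻¹' {w})))) +
        (log (μ.real (g ⁻¹' {t} ∩ h ⁻¹' {w})) - log (μ.real (h ⁻¹' {w})))) ≤
      ∑ w, ∑ t, ∑ s, (μ.real (f ⁻¹' {s} ∩ h ⁻¹' {w}) * μ.real (g ⁻¹' {t} ∩ h ⁻¹' {w}) /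
        μ.real (h ⁻¹' {w}) - μ.real (f ⁻¹' {s} ∩ (g ⁻¹' {t} ∩ h ⁻¹' {w}))) := by
    refine Finset.sum_le_sum fun w _ => Finset.sum_le_sum fun t _ =>
      Finset.sum_le_sum fun s _ => ?_
    exact mul_log_sub_log_le measureReal_nonneg
      (measureReal_mono (Set.inter_subset_inter_right _ Set.inter_subset_right))
      (measureReal_mono Set.inter_subset_right) (measureReal_mono Set.inter_subset_right)
  have zero : ∑ w, ∑ t, ∑ s, (μ.real (f ⁻¹' {s} ∩ h ⁻¹' {w}) *
      μ.real (g ⁻¹' {t} ∩ h ⁻¹' {w}) / μ.real (h ⁻¹' {w}) -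
        μ.real (f ⁻¹' {s} ∩ (g ⁻¹' {t} ∩ h ⁻¹' {w}))) = 0 := by
    refine Finset.sum_eq_zero fun w _ => ?_
    simp only [Finset.sum_sub_distrib, ← Finset.sum_div, ← Finset.sum_mul, ← Finset.mul_sum,
      sum_measureReal_fiber_inter μ hg, sum_measureReal_fiber_inter μ hf, mul_self_div_self,
      sub_self]
  rw [zero] at key
  simp only [mul_add, mul_sub, Finset.sum_add_distrib, Finset.sum_sub_distrib] at key
  rw [e1, e2, e3, e4]
  linarith

/-- Conditioning on a finer function decreases the conditional entropy. -/
lemma fiberEntropy_pair_sub_le [Fintype S] [Fintype S'] [Fintype W] {f' : X → S'} {f : X → S}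
    {h : X → W} (hf' : MeasFibers f') (hf : MeasFibers f) (hh : MeasFibers h)
    (hhf : ∀ x y, h x = h y → f x = f y) :
    fiberEntropy μ (fun x => (f' x, h x)) - fiberEntropy μ h ≤
      fiberEntropy μ (fun x => (f' x, f x)) - fiberEntropy μ f := by
  have h1 := fiberEntropy_submodular μ hf' hh f
  have h2 : fiberEntropy μ (fun x => (f' x, h x)) ≤ fiberEntropy μ (fun x => (f' x, h x, f x)) :=
    fiberEntropy_mono μ (hf'.pair (hh.pair hf)) fun x y hxy => by
      simp only [Prod.mk.injEq] at hxy ⊢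
      exact ⟨hxy.1, hxy.2.1⟩
  have h3 : fiberEntropy μ (fun x => (h x, f x)) ≤ fiberEntropy μ h :=
    fiberEntropy_mono μ hh fun x y hxy => by
      simp only [Prod.mk.injEq]
      exact ⟨hxy, hhf x y hxy⟩
  linarith

lemma fiberEntropy_itinerary_pair_le [Fintype S] [Fintype S'] [Fintype W] {f' : X → S'}
    {f : X → S} {h : X → W} (hf' : MeasFibers f') (hf : MeasFibers f) (hh : MeasFibers h)
    {T : X → X} (hT : MeasurePreserving T μ μ) (N : ℕ)
    (hhf : ∀ x y, h x = h y → itinerary T f N x = itinerary T f N y) :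
    fiberEntropy μ (fun x => (itinerary T f' N x, h x)) ≤ fiberEntropy μ h +
      N * (fiberEntropy μ (fun x => (f' x, f x)) - fiberEntropy μ f) := by
  induction N with
  | zero =>
    simp only [Nat.cast_zero, zero_mul, add_zero]
    exact fiberEntropy_mono μ hh fun x y hxy => by
      simp only [Prod.mk.injEq]
      exact ⟨Subsingleton.elim _ _, hxy⟩
  | succ N ih =>
    have hN := hT.iterate N
    have ih := ih fun x y hxy => ((itinerary_succ_eq_iff T f N x y).1 (hhf x y hxy)).1
    have hI := hf'.itinerary hT.measurable N
    have hfN := hf.comp hN.measurable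
    have hfN' := hf'.comp hN.measurable
    have h1 := fiberEntropy_submodular μ hI hfN' h
    have h2 : fiberEntropy μ (fun x => (itinerary T f' (N + 1) x, h x)) =
        fiberEntropy μ (fun x => (itinerary T f' N x, f' (T^[N] x), h x)) :=
      fiberEntropy_congr μ fun x y => by
        simp only [Prod.mk.injEq, itinerary_succ_eq_iff, and_assoc]
    have h3 := fiberEntropy_pair_sub_le μ hfN' hfN hh
      fun x y hxy => ((itinerary_succ_eq_iff T f N x y).1 (hhf x y hxy)).2
    have h4 := fiberEntropy_comp μ (hf'.pair hf) hN
    have h5 := fiberEntropy_comp μ hf hN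
    push_cast
    linarith

lemma Represents.entCondPart_eq [Fintype S] [Fintype W] {f : X → S} {b : X → W}
    {α β : Finset (Set X)} (hα : Represents f α) (hβ : Represents b β) (hf : MeasFibers f)
    (hb : MeasFibers b) :
    entCondPart μ α β = fiberEntropy μ (fun x => (f x, b x)) - fiberEntropy μ b := by
  rw [entCondPart, hβ.sum_eq _ (by simp), fiberEntropy_pair_sub μ hf b]
  refine Finset.sum_congr rfl fun w _ => ?_
  rw [entPart, hα.sum_eq _ (by simp), Finset.mul_sum]
  refine Finset.sum_congr rfl fun s _ => ?_
  rw [ProbabilityTheory.cond_apply (hb w), ENNReal.toReal_mul, ENNReal.toReal_inv,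
    Set.inter_comm]
  change μ.real _ * negMulLog ((μ.real _)⁻¹ * μ.real _) = _
  have hle : μ.real (f ⁻¹' {s} ∩ b ⁻¹' {w}) ≤ μ.real (b ⁻¹' {w}) :=
    measureReal_mono Set.inter_subset_right
  rcases (measureReal_nonneg (μ := μ) (s := f ⁻¹' {s} ∩ b ⁻¹' {w})).eq_or_lt with h | h
  · simp [← h]
  · have hd := h.trans_le hle
    rw [negMulLog, log_mul (inv_ne_zero hd.ne') h.ne', log_inv]
    field_simp
    ring

/-- If `α` determines `f`, the entropy of a partition represented by `f'` exceeds that of `α` by at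
most the static conditional entropy of `f'` given `f`. -/
lemma hPart_le_add [Fintype S] [Fintype S'] [Fintype W] {f : X → S} {f' : X → S'} {a : X → W}
    {α α' β : Finset (Set X)} (hα : Represents a α) (hα' : Represents f' α')
    (hβ : IsPartition β) (hβm : MeasF β) (ha : MeasFibers a) (hf : MeasFibers f)
    (hf' : MeasFibers f') (haf : ∀ x y, a x = a y → f x = f y)
    {T : X → X} (hT : MeasurePreserving T μ μ) :
    hPart T μ α' β ≤
      hPart T μ α β + (fiberEntropy μ (fun x => (f' x, f x)) - fiberEntropy μ f) := by
  obtain ⟨b, hb, hbf⟩ := hβ.exists_represents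
  have hbm : MeasFibers b := fun B => by
    rw [show b ⁻¹' {B} = B.1 from Set.ext (hbf B)]; exact hβm _ B.2
  rw [← sub_le_iff_le_add]
  refine le_ciInf fun N => ?_
  rw [sub_le_iff_le_add]
  refine (ciInf_le ⟨0, ?_⟩ N).trans ?_
  · rintro _ ⟨n, rfl⟩
    exact div_nonneg (entCondPart_nonneg μ _ _) (by positivity)
  have hN : (0 : ℝ) < N + 1 := by positivity
  rw [div_le_iff₀ hN, add_mul, div_mul_cancel₀ _ hN.ne']
  have hB := hbm.itinerary hT.measurable (N + 1)
  have hA := ha.itinerary hT.measurable (N + 1)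
  have hF := hf.itinerary hT.measurable (N + 1)
  have hF' := hf'.itinerary hT.measurable (N + 1)
  rw [(hα'.dynJoin T (N + 1)).entCondPart_eq μ (hb.dynJoin T (N + 1)) hF' hB,
    (hα.dynJoin T (N + 1)).entCondPart_eq μ (hb.dynJoin T (N + 1)) hA hB]
  have h1 := fiberEntropy_itinerary_pair_le μ hf' hf (hF.pair hB) hT (N + 1) fun x y hxy => by
    simp only [Prod.mk.injEq] at hxy
    exact hxy.1
  have h2 : fiberEntropy μ (fun x => (itinerary T f' (N + 1) x, itinerary T b (N + 1) x)) ≤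
      fiberEntropy μ (fun x =>
        (itinerary T f' (N + 1) x, itinerary T f (N + 1) x, itinerary T b (N + 1) x)) :=
    fiberEntropy_mono μ (hF'.pair (hF.pair hB)) fun x y hxy => by
      simp only [Prod.mk.injEq] at hxy ⊢
      exact ⟨hxy.1, hxy.2.2⟩
  have h3 : fiberEntropy μ (fun x => (itinerary T f (N + 1) x, itinerary T b (N + 1) x)) ≤
      fiberEntropy μ (fun x => (itinerary T a (N + 1) x, itinerary T b (N + 1) x)) :=
    fiberEntropy_mono μ (hA.pair hB) fun x y hxy => by
      simp only [Prod.mk.injEq] at hxy ⊢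
      exact ⟨funext fun i => haf _ _ (congrFun hxy.1 i), hxy.2⟩
  push_cast at h1
  linarith

/-- The conditional entropy of `f'` given `f` is small when the two functions agree outside a set
of small measure. -/
lemma fiberEntropy_pair_sub_le_of_close [Fintype S] {f f' : X → S} (hf : MeasFibers f)
    (hf' : MeasFibers f') {δ η : ℝ} (hδη : δ ≤ η)
    (hδ : ∀ x, 0 ≤ x → x ≤ δ → negMulLog x ≤ η) (hclose : μ.real {x | f' x ≠ f x} ≤ δ) :
    fiberEntropy μ (fun x => (f' x, f x)) - fiberEntropy μ f ≤
      Fintype.card S * (Fintype.card S * η) := by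
  classical
  rw [fiberEntropy_pair_sub μ hf' f, ← nsmul_eq_mul, ← nsmul_eq_mul]
  refine Finset.sum_le_card_nsmul _ _ _ fun t _ => Finset.sum_le_card_nsmul _ _ _ fun s _ => ?_
  have hle : μ.real (f' ⁻¹' {s} ∩ f ⁻¹' {t}) ≤ μ.real (f ⁻¹' {t}) :=
    measureReal_mono Set.inter_subset_right
  have hδ0 : 0 ≤ δ := measureReal_nonneg.trans hclose
  rcases (measureReal_nonneg (μ := μ) (s := f' ⁻¹' {s} ∩ f ⁻¹' {t})).eq_or_lt with h | h
  · rw [← h, zero_mul]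
    exact hδ0.trans hδη
  have hd := h.trans_le hle
  by_cases hst : s = t
  · subst hst
    calc _ = μ.real (f' ⁻¹' {s} ∩ f ⁻¹' {s}) *
          log (μ.real (f ⁻¹' {s}) / μ.real (f' ⁻¹' {s} ∩ f ⁻¹' {s})) := by
          rw [log_div hd.ne' h.ne']
      _ ≤ μ.real (f' ⁻¹' {s} ∩ f ⁻¹' {s}) *
          (μ.real (f ⁻¹' {s}) / μ.real (f' ⁻¹' {s} ∩ f ⁻¹' {s}) - 1) :=
          mul_le_mul_of_nonneg_left (log_le_sub_one_of_pos (div_pos hd h)) h.le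
      _ = μ.real (f ⁻¹' {s}) - μ.real (f' ⁻¹' {s} ∩ f ⁻¹' {s}) := by field_simp
      _ = μ.real (f ⁻¹' {s} \ (f' ⁻¹' {s} ∩ f ⁻¹' {s})) :=
          (measureReal_sdiff Set.inter_subset_right ((hf' s).inter (hf s))).symm
      _ ≤ μ.real {x | f' x ≠ f x} := by
          refine measureReal_mono ?_
          rintro x ⟨hx, hx'⟩ he
          exact hx' ⟨he.trans hx, hx⟩
      _ ≤ η := hclose.trans hδη
  · have hsmall : μ.real (f' ⁻¹' {s} ∩ f ⁻¹' {t}) ≤ δ := by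
      refine (measureReal_mono ?_).trans hclose
      rintro x ⟨hx, hx'⟩ he
      exact hst (hx.symm.trans (he.trans hx'))
    refine le_trans ?_ (hδ _ h.le hsmall)
    have := log_nonpos measureReal_nonneg (measureReal_le_one (μ := μ) (s := f ⁻¹' {t}))
    rw [negMulLog]
    nlinarith

lemma exists_measFibers_of_iUnion_eq_univ {M : ℕ} {V : Fin M → Set X}
    (hV : ∀ m, MeasurableSet (V m)) (hVc : (⋃ m, V m) = Set.univ) :
    ∃ k : X → Fin M, MeasFibers k ∧ ∀ x, x ∈ V (k x) := by
  classical
  have hex : ∀ x, ∃ m, x ∈ V m := fun x => by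
    simpa using (hVc.symm ▸ Set.mem_univ x : x ∈ ⋃ m, V m)
  refine ⟨fun x => Fin.find (fun m => x ∈ V m) (hex x), fun m => ?_,
    fun x => Fin.find_spec (hex x)⟩
  have : (fun x => Fin.find (fun m => x ∈ V m) (hex x)) ⁻¹' {m} =
      V m ∩ ⋂ j : Fin M, ⋂ _ : j < m, (V j)ᶜ := by
    ext x
    simp [Fin.find_eq_iff]
  rw [this]
  exact (hV m).inter (MeasurableSet.iInter fun j => MeasurableSet.iInter fun _ => (hV j).compl)

/-- A selection `f` of a cover `U` can be modified to a selection of `V` by changing it only on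
the part of `U` not covered by the corresponding members of `V`. -/
lemma exists_selection_close {M : ℕ} {U V : Fin M → Set X}
    (hV : ∀ m, MeasurableSet (V m)) (hVc : (⋃ m, V m) = Set.univ) {f : X → Fin M}
    (hf : MeasFibers f) (hfU : ∀ x, x ∈ U (f x)) :
    ∃ f' : X → Fin M, MeasFibers f' ∧ (∀ x, x ∈ V (f' x)) ∧
      μ.real {x | f' x ≠ f x} ≤ ∑ m, (μ (symmDiff (U m) (V m))).toReal := by
  classical
  obtain ⟨k, hk, hkV⟩ := exists_measFibers_of_iUnion_eq_univ hV hVc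
  refine ⟨fun x => if x ∈ V (f x) then f x else k x, fun m => ?_, fun x => ?_, ?_⟩
  · have hG : MeasurableSet {x | x ∈ V (f x)} := by
      have : {x | x ∈ V (f x)} = ⋃ j, f ⁻¹' {j} ∩ V j := by
        ext x; simp
      rw [this]
      exact MeasurableSet.iUnion fun j => (hf j).inter (hV j)
    have : (fun x => if x ∈ V (f x) then f x else k x) ⁻¹' {m} =
        ({x | x ∈ V (f x)} ∩ f ⁻¹' {m}) ∪ ({x | x ∈ V (f x)}ᶜ ∩ k ⁻¹' {m}) := by
      ext x
      by_cases hx : x ∈ V (f x) <;> simp [hx]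
    rw [this]
    exact (hG.inter (hf m)).union (hG.compl.inter (hk m))
  · by_cases hx : x ∈ V (f x)
    · simp [hx]
    · simp [hx, hkV x]
  · refine (measureReal_mono ?_).trans (measureReal_iUnion_fintype_le _)
    intro x hx
    by_cases hxV : x ∈ V (f x)
    · simp [hxV] at hx
    · exact Set.mem_iUnion.2 ⟨f x, Or.inl ⟨hfU x, hxV⟩⟩

lemma hPlus_le_add {M : ℕ} {U V : Fin M → Set X} (hU : ∀ m, MeasurableSet (U m))
    (hUc : (⋃ m, U m) = Set.univ) (hV : ∀ m, MeasurableSet (V m))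
    (hVc : (⋃ m, V m) = Set.univ) {β : Finset (Set X)} (hβ : IsPartition β) (hβm : MeasF β)
    {T : X → X} (hT : MeasurePreserving T μ μ) {δ η : ℝ} (hδη : δ ≤ η)
    (hδ : ∀ x, 0 ≤ x → x ≤ δ → negMulLog x ≤ η)
    (hUV : ∑ m, (μ (symmDiff (U m) (V m))).toReal ≤ δ) :
    hPlus T μ (rangeFinset V) β ≤ hPlus T μ (rangeFinset U) β + M * (M * η) := by
  have refines_of_selection : ∀ {U : Fin M → Set X} {f : X → Fin M}, (∀ x, x ∈ U (f x)) →
      Refines (fiberFamily f) (rangeFinset U) := by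
    intro U f hfU A hA
    obtain ⟨m, rfl⟩ := mem_fiberFamily.1 hA
    refine ⟨U m, by simp [rangeFinset], fun x hx => ?_⟩
    rw [← show f x = m from hx]
    exact hfU x
  have measF : ∀ {f : X → Fin M}, MeasFibers f → MeasF (fiberFamily f) := by
    intro f hf A hA
    obtain ⟨m, rfl⟩ := mem_fiberFamily.1 hA
    exact hf m
  rw [← sub_le_iff_le_add]
  refine le_csInf ?_ ?_
  · obtain ⟨k, hk, hkU⟩ := exists_measFibers_of_iUnion_eq_univ hU hUc
    exact ⟨_, fiberFamily k, isPartition_fiberFamily k, measF hk, refines_of_selection hkU, rfl⟩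
  rintro _ ⟨α, hα, hαm, hαU, rfl⟩
  rw [sub_le_iff_le_add]
  obtain ⟨a, ha, haf⟩ := hα.exists_represents
  have ham : MeasFibers a := fun A => by
    rw [show a ⁻¹' {A} = A.1 from Set.ext (haf A)]; exact hαm _ A.2
  have hsel : ∀ A : α, ∃ m, A.1 ⊆ U m := fun A => by
    obtain ⟨B, hB, hAB⟩ := hαU A.1 A.2
    obtain ⟨m, rfl⟩ : ∃ m, U m = B := by simpa [rangeFinset] using hB
    exact ⟨m, hAB⟩
  choose φ hφ using hsel
  have hf : MeasFibers fun x => φ (a x) := ham.map φ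
  obtain ⟨f', hf', hfV, hclose⟩ := exists_selection_close μ hV hVc hf
    fun x => hφ (a x) ((haf (a x) x).1 rfl)
  have h1 := hPart_le_add μ ha (represents_fiberFamily f') hβ hβm ham hf hf'
    (fun x y hxy => congrArg φ hxy) hT
  have h2 := fiberEntropy_pair_sub_le_of_close μ hf hf' hδη hδ (hclose.trans hUV)
  rw [Fintype.card_fin] at h2
  have h3 : hPlus T μ (rangeFinset V) β ≤ hPart T μ (fiberFamily f') β := by
    refine csInf_le ⟨0, ?_⟩ ⟨fiberFamily f', isPartition_fiberFamily f', measF hf',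
      refines_of_selection hfV, rfl⟩
    rintro _ ⟨γ, -, -, -, rfl⟩
    exact hPart_nonneg μ T γ β
  linarith

end FiberEntropy

lemma exists_pos_negMulLog_le {η : ℝ} (hη : 0 < η) :
    ∃ δ : ℝ, 0 < δ ∧ δ ≤ η ∧ ∀ x, 0 ≤ x → x ≤ δ → negMulLog x ≤ η := by
  obtain ⟨δ, hδ, h⟩ := Metric.continuousAt_iff.1 (continuous_negMulLog.continuousAt (x := 0)) η hη
  refine ⟨min (δ / 2) η, by positivity, min_le_right _ _, fun x hx hxδ => ?_⟩
  have hxδ' : x < δ := by linarith [hxδ.trans (min_le_left _ _)]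
  have := h (x := x) (by simpa [abs_of_nonneg hx] using hxδ')
  rw [negMulLog_zero, dist_zero_right, norm_eq_abs] at this
  exact (le_abs_self _).trans this.le

end Paper

/-- Let `(X,T)` be a TDS, `μ ∈ M_T(X)` and `β` a finite Borel partition.
For every `M ∈ ℕ` and `ε > 0` there is `δ > 0` such that for all Borel covers
`U = {U_1,…,U_M}` and `V = {V_1,…,V_M}` with `μ(U Δ V) = ∑_m μ(U_m Δ V_m) < δ` one has
`|h⁺_μ(U|β,T) - h⁺_μ(V|β,T)| ≤ ε`. -/
theorem statement18 {X : Type*} [MetricSpace X] [CompactSpace X]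
    [MeasurableSpace X] [BorelSpace X] (T : X ≃ₜ X)
    (μ : MeasureTheory.Measure X) [MeasureTheory.IsProbabilityMeasure μ]
    (hT : MeasureTheory.MeasurePreserving (⇑T) μ μ)
    (β : Finset (Set X)) (hβ : IsPartition β) (hβm : MeasF β)
    (M : ℕ) (ε : ℝ) (hε : 0 < ε) :
    ∃ δ : ℝ, 0 < δ ∧
      ∀ U V : Fin M → Set X,
        (∀ m, MeasurableSet (U m)) → (⋃ m, U m) = Set.univ →
        (∀ m, MeasurableSet (V m)) → (⋃ m, V m) = Set.univ →
        (∑ m : Fin M, (μ (symmDiff (U m) (V m))).toReal) < δ →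
        |hPlus (⇑T) μ (rangeFinset U) β - hPlus (⇑T) μ (rangeFinset V) β| ≤ ε := by
  have hη : 0 < ε / (M * M + 1) := by positivity
  obtain ⟨δ, hδ0, hδη, hδ⟩ := exists_pos_negMulLog_le hη
  have hM : (M : ℝ) * (M * (ε / (M * M + 1))) ≤ ε := by
    rw [← mul_assoc, ← mul_div_assoc, div_le_iff₀ (by positivity)]
    nlinarith
  refine ⟨δ, hδ0, fun U V hU hUc hV hVc hUV => ?_⟩
  have h1 := hPlus_le_add μ hU hUc hV hVc hβ hβm hT hδη hδ hUV.le
  have h2 := hPlus_le_add μ hV hVc hU hUc hβ hβm hT hδη hδ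
    (by simpa only [symmDiff_comm] using hUV.le)
  rw [abs_le]
  constructor <;> linarith
end

section
/- Let (X,T) be a TDS. Then for every cover U of X (not necessarily open), every finite Borel partition β of X, and every μ ∈ M_T(X), h^+_μ(U|β,T) = h^-_μ(U|β,T). -/
open MeasureTheory Real Filter

open Paper MeasureTheory Real Filter
namespace CoverEntropy

/-- All fibres of `f` are measurable. -/
def FiberMeas {X ι : Type*} [MeasurableSpace X] (f : X → ι) : Prop :=
  ∀ i, MeasurableSet (f ⁻¹' {i})

/-- The Shannon entropy of a finite-valued function. -/
noncomputable def ent {X ι : Type*} [MeasurableSpace X] [Fintype ι] (μ : Measure X)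
    (f : X → ι) : ℝ :=
  ∑ i, negMulLog (μ.real (f ⁻¹' {i}))

/-- The conditional Shannon entropy of `f` given `g`. -/
noncomputable def cent {X ι κ : Type*} [MeasurableSpace X] [Fintype ι] [Fintype κ]
    (μ : Measure X) (f : X → ι) (g : X → κ) : ℝ :=
  ent μ (fun x => (f x, g x)) - ent μ g

lemma preimage_pair {X ι κ : Type*} (f : X → ι) (g : X → κ) (i : ι) (j : κ) :
    (fun x => (f x, g x)) ⁻¹' {(i, j)} = f ⁻¹' {i} ∩ g ⁻¹' {j} := by
  ext x; simp

lemma negMulLog_sum_le {ι : Type*} {s : Finset ι} {p : ι → ℝ} (hp : ∀ i ∈ s, 0 ≤ p i) :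
    negMulLog (∑ i ∈ s, p i) ≤ ∑ i ∈ s, negMulLog (p i) := by
  rw [negMulLog, neg_mul, Finset.sum_mul, ← Finset.sum_neg_distrib]
  refine Finset.sum_le_sum fun i hi => ?_
  rw [negMulLog, neg_mul, neg_le_neg_iff]
  rcases (hp i hi).eq_or_lt with h | h
  · simp [← h]
  · exact mul_le_mul_of_nonneg_left (log_le_log h (Finset.single_le_sum hp hi)) h.le

lemma exists_comp_eq {X ι κ : Type*} [Nonempty X] {f : X → ι} {f' : X → κ}
    (h : ∀ x y, f' x = f' y → f x = f y) : ∃ φ : κ → ι, f = fun x => φ (f' x) := by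
  have : Nonempty ι := ⟨f (Classical.arbitrary X)⟩
  obtain ⟨φ, hφ⟩ := (Function.factorsThrough_iff f).1 fun x y hxy => h x y hxy
  exact ⟨φ, hφ⟩

section FiberMeas

variable {X ι κ : Type*} [MeasurableSpace X]

lemma FiberMeas.preimage [Finite ι] {f : X → ι} (hf : FiberMeas f) (s : Set ι) :
    MeasurableSet (f ⁻¹' s) := by
  rw [← Set.biUnion_preimage_singleton]
  exact MeasurableSet.biUnion (Set.to_countable s) fun i _ => hf i

lemma FiberMeas.comp [Finite ι] {f : X → ι} (hf : FiberMeas f) (φ : ι → κ) :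
    FiberMeas fun x => φ (f x) := fun k => by
  have := hf.preimage (φ ⁻¹' {k})
  rwa [← Set.preimage_comp] at this

lemma FiberMeas.prodMk {f : X → ι} {g : X → κ} (hf : FiberMeas f) (hg : FiberMeas g) :
    FiberMeas fun x => (f x, g x) := fun ⟨i, j⟩ => by
  rw [preimage_pair]; exact (hf i).inter (hg j)

lemma FiberMeas.pi {n : ℕ} {f : Fin n → X → ι} (hf : ∀ k, FiberMeas (f k)) :
    FiberMeas fun x k => f k x := fun v => by
  have : (fun x k => f k x) ⁻¹' {v} = ⋂ k, f k ⁻¹' {v k} := by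
    ext x; simp [funext_iff]
  rw [this]; exact MeasurableSet.iInter fun k => hf k (v k)

lemma FiberMeas.comp_measurable {f : X → ι} (hf : FiberMeas f) {T : X → X} (hT : Measurable T) :
    FiberMeas fun x => f (T x) := fun i => hT (hf i)

end FiberMeas

lemma real_fiber_comp {X ι κ : Type*} [MeasurableSpace X] [Fintype ι] [DecidableEq κ]
    (μ : Measure X) [IsFiniteMeasure μ] {f : X → ι}
    (hf : FiberMeas f) (φ : ι → κ) (k : κ) :
    μ.real ((fun x => φ (f x)) ⁻¹' {k}) = ∑ i with φ i = k, μ.real (f ⁻¹' {i}) := by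
  rw [← measureReal_biUnion_finset]
  · congr 1; ext x; simp
  · intro i _ j _ hij
    refine Set.disjoint_left.2 fun x hx hy => hij ?_
    rw [← hx, ← hy]
  · exact fun i _ => hf i

section Entropy

variable {X ι κ ο : Type*} [MeasurableSpace X] [Fintype ι] [Fintype κ] [Fintype ο]

lemma sum_real_inter (μ : Measure X) [IsFiniteMeasure μ] {f : X → ι} (hf : FiberMeas f)
    {A : Set X} (hA : MeasurableSet A) :
    ∑ i, μ.real (A ∩ f ⁻¹' {i}) = μ.real A := by
  rw [← measureReal_biUnion_finset]
  · congr 1; ext x; simp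
  · intro i _ j _ hij
    refine Set.disjoint_left.2 fun x hx hy => hij ?_
    rw [← hx.2, ← hy.2]
  · exact fun i _ => hA.inter (hf i)

lemma sum_real_inter' (μ : Measure X) [IsFiniteMeasure μ] {f : X → ι} (hf : FiberMeas f)
    {A : Set X} (hA : MeasurableSet A) :
    ∑ i, μ.real (f ⁻¹' {i} ∩ A) = μ.real A := by
  simp_rw [Set.inter_comm _ A]; exact sum_real_inter μ hf hA

lemma sum_real_fiber (μ : Measure X) [IsProbabilityMeasure μ] {f : X → ι} (hf : FiberMeas f) :
    ∑ i, μ.real (f ⁻¹' {i}) = 1 := by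
  simpa using sum_real_inter μ hf MeasurableSet.univ

lemma ent_pair (μ : Measure X) (f : X → ι) (g : X → κ) :
    ent μ (fun x => (f x, g x)) = ∑ j, ∑ i, negMulLog (μ.real (f ⁻¹' {i} ∩ g ⁻¹' {j})) := by
  rw [ent, Fintype.sum_prod_type, Finset.sum_comm]
  simp_rw [preimage_pair]

lemma cent_eq_sum (μ : Measure X) [IsFiniteMeasure μ] {f : X → ι} {g : X → κ}
    (hf : FiberMeas f) (hg : FiberMeas g) :
    cent μ f g = ∑ j, ∑ i, μ.real (f ⁻¹' {i} ∩ g ⁻¹' {j}) *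
      -log (μ.real (f ⁻¹' {i} ∩ g ⁻¹' {j}) / μ.real (g ⁻¹' {j})) := by
  rw [cent, ent_pair, ent, ← Finset.sum_sub_distrib]
  refine Finset.sum_congr rfl fun j _ => ?_
  have h1 : negMulLog (μ.real (g ⁻¹' {j})) =
      ∑ i, μ.real (f ⁻¹' {i} ∩ g ⁻¹' {j}) * -log (μ.real (g ⁻¹' {j})) := by
    rw [← Finset.sum_mul, sum_real_inter' μ hf (hg j), negMulLog]; ring
  rw [h1, ← Finset.sum_sub_distrib]
  refine Finset.sum_congr rfl fun i _ => ?_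
  rcases eq_or_ne (μ.real (f ⁻¹' {i} ∩ g ⁻¹' {j})) 0 with h | h
  · simp [h]
  · have h2 : μ.real (g ⁻¹' {j}) ≠ 0 := fun h0 => h <| le_antisymm
      (h0 ▸ measureReal_mono Set.inter_subset_right) measureReal_nonneg
    rw [log_div h h2, negMulLog]; ring

/-- Gibbs' inequality: conditional entropy is at most conditional cross entropy. -/
lemma cent_le_cross (μ : Measure X) [IsFiniteMeasure μ] {f : X → ι} {g : X → κ}
    (hf : FiberMeas f) (hg : FiberMeas g) (q : ι → κ → ℝ) (hq : ∀ i j, 0 ≤ q i j)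
    (hq1 : ∀ j, ∑ i, q i j ≤ 1)
    (hpos : ∀ i j, 0 < μ.real (f ⁻¹' {i} ∩ g ⁻¹' {j}) → 0 < q i j) :
    cent μ f g ≤ ∑ j, ∑ i, μ.real (f ⁻¹' {i} ∩ g ⁻¹' {j}) * -log (q i j) := by
  rw [cent_eq_sum μ hf hg]
  refine Finset.sum_le_sum fun j _ => ?_
  have key : ∀ i, μ.real (f ⁻¹' {i} ∩ g ⁻¹' {j}) *
      -log (μ.real (f ⁻¹' {i} ∩ g ⁻¹' {j}) / μ.real (g ⁻¹' {j})) ≤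
      μ.real (f ⁻¹' {i} ∩ g ⁻¹' {j}) * -log (q i j) +
      (q i j * μ.real (g ⁻¹' {j}) - μ.real (f ⁻¹' {i} ∩ g ⁻¹' {j})) := by
    intro i
    rcases (measureReal_nonneg (μ := μ) (s := f ⁻¹' {i} ∩ g ⁻¹' {j})).eq_or_lt with h | h
    · rw [← h]; simpa using mul_nonneg (hq i j) measureReal_nonneg
    · have hg0 : 0 < μ.real (g ⁻¹' {j}) := h.trans_le (measureReal_mono Set.inter_subset_right)
      have hq0 := hpos i j h
      set p := μ.real (f ⁻¹' {i} ∩ g ⁻¹' {j})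
      set r := μ.real (g ⁻¹' {j})
      have h3 : log (q i j * r / p) ≤ q i j * r / p - 1 := log_le_sub_one_of_pos (by positivity)
      rw [log_div (by positivity) h.ne', log_mul hq0.ne' hg0.ne'] at h3
      rw [log_div h.ne' hg0.ne']
      have h4 := mul_le_mul_of_nonneg_left h3 h.le
      have h5 : p * (q i j * r / p - 1) = q i j * r - p := by field_simp
      linarith
  refine (Finset.sum_le_sum fun i _ => key i).trans ?_
  rw [Finset.sum_add_distrib, Finset.sum_sub_distrib, sum_real_inter' μ hf (hg j),
    ← Finset.sum_mul]
  have := mul_le_mul_of_nonneg_right (hq1 j) (measureReal_nonneg (μ := μ) (s := g ⁻¹' {j}))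
  linarith

lemma ent_comp_le (μ : Measure X) [IsFiniteMeasure μ] {f : X → ι} (hf : FiberMeas f)
    (φ : ι → κ) : ent μ (fun x => φ (f x)) ≤ ent μ f := by
  classical
  rw [ent, ent, ← Finset.sum_fiberwise Finset.univ φ]
  refine Finset.sum_le_sum fun k _ => ?_
  rw [real_fiber_comp μ hf]
  exact negMulLog_sum_le fun i _ => measureReal_nonneg

lemma ent_le_of_determines (μ : Measure X) [IsProbabilityMeasure μ] {f : X → ι} {f' : X → κ}
    (hf' : FiberMeas f') (h : ∀ x y, f' x = f' y → f x = f y) : ent μ f ≤ ent μ f' := by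
  have : Nonempty X := nonempty_of_isProbabilityMeasure μ
  obtain ⟨φ, rfl⟩ := exists_comp_eq h
  exact ent_comp_le μ hf' φ

lemma cent_le_of_determines (μ : Measure X) [IsProbabilityMeasure μ] {f : X → ι} {f' : X → κ}
    {g : X → ο} (hf' : FiberMeas f') (hg : FiberMeas g)
    (h : ∀ x y, f' x = f' y → g x = g y → f x = f y) : cent μ f g ≤ cent μ f' g := by
  refine sub_le_sub_right (ent_le_of_determines μ (hf'.prodMk hg) ?_) _
  rintro x y hxy
  simp only [Prod.mk.injEq] at hxy ⊢
  exact ⟨h x y hxy.1 hxy.2, hxy.2⟩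

lemma cent_comp_cond_le (μ : Measure X) [IsFiniteMeasure μ] {f : X → ι} {g : X → κ}
    (hf : FiberMeas f) (hg : FiberMeas g) (φ : κ → ο) :
    cent μ f g ≤ cent μ f (fun x => φ (g x)) := by
  classical
  have hφ : FiberMeas fun x => φ (g x) := hg.comp φ
  have hsub : ∀ j, g ⁻¹' {j} ⊆ (fun x => φ (g x)) ⁻¹' {φ j} := by
    intro j x hx; simp only [Set.mem_preimage, Set.mem_singleton_iff] at hx ⊢; rw [hx]
  refine (cent_le_cross μ hf hg (fun i j => μ.real (f ⁻¹' {i} ∩ (fun x => φ (g x)) ⁻¹' {φ j}) /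
    μ.real ((fun x => φ (g x)) ⁻¹' {φ j})) (fun i j => by positivity) (fun j => ?_)
    (fun i j h => ?_)).trans_eq ?_
  · rw [← Finset.sum_div, sum_real_inter' μ hf (hφ _)]
    exact div_self_le_one _
  · have h1 := h.trans_le (measureReal_mono (Set.inter_subset_inter_right _ (hsub j)))
    exact div_pos h1 (h1.trans_le (measureReal_mono Set.inter_subset_right))
  · rw [cent_eq_sum μ hf hφ, ← Finset.sum_fiberwise Finset.univ φ]
    refine Finset.sum_congr rfl fun k _ => ?_
    rw [Finset.sum_comm]
    refine Finset.sum_congr rfl fun i _ => ?_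
    have h2 : μ.real (f ⁻¹' {i} ∩ (fun x => φ (g x)) ⁻¹' {k}) =
        ∑ j with φ j = k, μ.real (f ⁻¹' {i} ∩ g ⁻¹' {j}) := by
      rw [← measureReal_biUnion_finset]
      · congr 1; ext x; simp
      · intro a _ b _ hab
        refine Set.disjoint_left.2 fun x hx hy => hab ?_
        rw [← hx.2, ← hy.2]
      · exact fun j _ => (hf i).inter (hg j)
    conv_rhs => rw [h2, Finset.sum_mul]
    refine Finset.sum_congr rfl fun j hj => ?_
    rw [(Finset.mem_filter.1 hj).2, ← h2]

lemma cent_cond_le_of_determines (μ : Measure X) [IsProbabilityMeasure μ] {f : X → ι}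
    {g : X → κ} {g' : X → ο} (hf : FiberMeas f) (hg : FiberMeas g)
    (h : ∀ x y, g x = g y → g' x = g' y) : cent μ f g ≤ cent μ f g' := by
  have : Nonempty X := nonempty_of_isProbabilityMeasure μ
  obtain ⟨φ, rfl⟩ := exists_comp_eq h
  exact cent_comp_cond_le μ hf hg φ

lemma cent_le_ent (μ : Measure X) [IsProbabilityMeasure μ] {f : X → ι} {g : X → κ}
    (hf : FiberMeas f) (hg : FiberMeas g) : cent μ f g ≤ ent μ f := by
  refine (cent_cond_le_of_determines μ (g' := fun _ => ()) hf hg fun _ _ _ => rfl).trans ?_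
  have h0 : ent μ (fun _ : X => ()) = 0 := by simp [ent, Set.preimage]
  rw [cent, h0, sub_zero]
  exact ent_le_of_determines μ hf fun x y hxy => by simp [hxy]

lemma cent_pair_le (μ : Measure X) [IsProbabilityMeasure μ] {f : X → ι} {f' : X → κ}
    {g : X → ο} (hf : FiberMeas f) (hf' : FiberMeas f') (hg : FiberMeas g) :
    cent μ (fun x => (f x, f' x)) g ≤ cent μ f g + cent μ f' g := by
  have h1 : cent μ f' (fun x => (f x, g x)) ≤ cent μ f' g :=
    cent_cond_le_of_determines μ hf' (hf.prodMk hg) fun x y h => (Prod.ext_iff.1 h).2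
  have h2 : ent μ (fun x => ((f x, f' x), g x)) ≤ ent μ (fun x => (f' x, (f x, g x))) :=
    ent_le_of_determines μ (hf'.prodMk (hf.prodMk hg)) fun x y h => by
      simp only [Prod.mk.injEq] at h ⊢; tauto
  unfold cent at *
  linarith

lemma ent_comp_preserving {μ : Measure X} {T : X → X} (hT : MeasurePreserving T μ μ)
    {f : X → ι} (hf : FiberMeas f) : ent μ (fun x => f (T x)) = ent μ f := by
  refine Finset.sum_congr rfl fun i _ => ?_
  have : (fun x => f (T x)) ⁻¹' {i} = T ⁻¹' (f ⁻¹' {i}) := rfl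
  rw [this, measureReal_def, hT.measure_preimage (hf i).nullMeasurableSet, measureReal_def]

lemma cent_comp_preserving {μ : Measure X} {T : X → X} (hT : MeasurePreserving T μ μ)
    {f : X → ι} {g : X → κ} (hf : FiberMeas f) (hg : FiberMeas g) :
    cent μ (fun x => f (T x)) (fun x => g (T x)) = cent μ f g := by
  rw [cent, cent, ent_comp_preserving hT hg, ← ent_comp_preserving hT (hf.prodMk hg)]

/-- Entropy of a partial observation: `f` is seen only on the set `E`. -/
lemma cent_partial_le (μ : Measure X) [IsProbabilityMeasure μ] {f : X → ι} {g : X → κ}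
    {F : X → Option ι} {E : Set X} (hF : FiberMeas F) (hg : FiberMeas g) (hE : MeasurableSet E)
    (hFE : ∀ x ∈ E, F x = some (f x)) (hFE' : ∀ x ∉ E, F x = none)
    (q : ι → κ → ℝ) (hq : ∀ i j, 0 ≤ q i j) (hq1 : ∀ j, ∑ i, q i j ≤ 1)
    (hpos : ∀ i j, 0 < μ.real (f ⁻¹' {i} ∩ g ⁻¹' {j}) → 0 < q i j) {τ : ℝ} (h0 : 0 < τ)
    (h1 : τ < 1) :
    cent μ F g ≤ (∑ j, ∑ i, μ.real (E ∩ (f ⁻¹' {i} ∩ g ⁻¹' {j})) * -log (q i j))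
      + μ.real E * -log τ + -log (1 - τ) := by
  have hs : ∀ i j, F ⁻¹' {some i} ∩ g ⁻¹' {j} = E ∩ (f ⁻¹' {i} ∩ g ⁻¹' {j}) := by
    intro i j; ext x
    by_cases hx : x ∈ E
    · simp [hx, hFE x hx]
    · simp [hx, hFE' x hx]
  have hs' : ∀ i, F ⁻¹' {some i} = E ∩ f ⁻¹' {i} := by
    intro i; ext x
    by_cases hx : x ∈ E
    · simp [hx, hFE x hx]
    · simp [hx, hFE' x hx]
  refine (cent_le_cross μ hF hg
    (fun o j => o.elim (1 - τ) fun i => τ * q i j) ?_ ?_ ?_).trans ?_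
  · rintro (_ | i) j
    · simpa using h1.le
    · exact mul_nonneg h0.le (hq i j)
  · intro j
    rw [Fintype.sum_option]
    simp only [Option.elim, ← Finset.mul_sum]
    nlinarith [hq1 j]
  · rintro (_ | i) j h
    · simpa using h1
    · rw [hs] at h
      exact mul_pos h0 (hpos i j (h.trans_le (measureReal_mono Set.inter_subset_right)))
  · simp only [Fintype.sum_option, Option.elim, hs, Finset.sum_add_distrib]
    have hlog : 0 ≤ -log (1 - τ) := by
      have := log_nonpos (by linarith : 0 ≤ 1 - τ) (by linarith)
      linarith
    have e1 : ∑ j, μ.real (F ⁻¹' {none} ∩ g ⁻¹' {j}) * -log (1 - τ) ≤ -log (1 - τ) := by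
      rw [← Finset.sum_mul, sum_real_inter μ hg (hF none)]
      exact mul_le_of_le_one_left hlog measureReal_le_one
    have e2 : ∀ i j, μ.real (E ∩ (f ⁻¹' {i} ∩ g ⁻¹' {j})) * -log (τ * q i j) =
        μ.real (E ∩ (f ⁻¹' {i} ∩ g ⁻¹' {j})) * -log τ +
        μ.real (E ∩ (f ⁻¹' {i} ∩ g ⁻¹' {j})) * -log (q i j) := by
      intro i j
      rcases (measureReal_nonneg (μ := μ) (s := E ∩ (f ⁻¹' {i} ∩ g ⁻¹' {j}))).eq_or_lt with h | h
      · simp [← h]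
      · rw [log_mul h0.ne'
          (hpos i j (h.trans_le (measureReal_mono Set.inter_subset_right))).ne']
        ring
    simp only [e2, Finset.sum_add_distrib]
    have e3 : ∑ j, ∑ i, μ.real (E ∩ (f ⁻¹' {i} ∩ g ⁻¹' {j})) * -log τ ≤ μ.real E * -log τ := by
      simp_rw [← Finset.sum_mul]
      have hτ : 0 ≤ -log τ := by have := log_nonpos h0.le h1.le; linarith
      refine mul_le_mul_of_nonneg_right (le_of_eq ?_) hτ
      rw [Finset.sum_comm]
      have : ∀ i, ∑ j, μ.real (E ∩ (f ⁻¹' {i} ∩ g ⁻¹' {j})) = μ.real (F ⁻¹' {some i}) := by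
        intro i
        simp_rw [← hs]
        exact sum_real_inter μ hg (hF _)
      simp_rw [this]
      have h4 := sum_real_inter' μ hF hE
      rw [Fintype.sum_option] at h4
      have h5 : F ⁻¹' {none} ∩ E = ∅ := by
        ext x; simp only [Set.mem_inter_iff, Set.mem_preimage, Set.mem_singleton_iff,
          Set.mem_empty_iff_false, iff_false, not_and]
        intro h hx; simp [hFE x hx] at h
      rw [h5, measureReal_empty, zero_add] at h4
      rw [← h4]
      refine Finset.sum_congr rfl fun i _ => ?_
      rw [hs', Set.inter_right_comm, Set.inter_self]
    linarith

end Entropy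

section Codes

/-- The nonempty members of the family `P` are exactly the nonempty fibres of `f`. -/
def Codes {X ι : Type*} (f : X → ι) (P : Finset (Set X)) : Prop :=
  (∀ A ∈ P, A.Nonempty → ∃ i, A = f ⁻¹' {i}) ∧ ∀ i, (f ⁻¹' {i}).Nonempty → f ⁻¹' {i} ∈ P

/-- The itinerary of length `M` of `f` along the orbit segment starting at time `s`. -/
def itin {X ι : Type*} (T : X → X) (f : X → ι) (s M : ℕ) (x : X) : Fin M → ι :=
  fun k => f (T^[s + k] x)

lemma Codes.sum_eq {X ι : Type*} [Fintype ι] {f : X → ι} {P : Finset (Set X)} (h : Codes f P)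
    (φ : Set X → ℝ) (hφ : φ ∅ = 0) : ∑ A ∈ P, φ A = ∑ i, φ (f ⁻¹' {i}) := by
  symm
  have hne : ∀ A, φ A ≠ 0 → A.Nonempty := fun A hA => by
    rw [Set.nonempty_iff_ne_empty]; rintro rfl; exact hA hφ
  refine Finset.sum_bij_ne_zero (fun i _ _ => f ⁻¹' {i}) ?_ ?_ ?_ ?_
  · exact fun i _ hi => h.2 i (hne _ hi)
  · intro i _ hi j _ hj hij
    obtain ⟨x, hx⟩ := hne _ hi
    have hx' : x ∈ f ⁻¹' {j} := hij ▸ hx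
    rw [← hx, ← hx']
  · intro A hA hA0
    obtain ⟨i, rfl⟩ := h.1 A hA (hne _ hA0)
    exact ⟨i, Finset.mem_univ _, hA0, rfl⟩
  · exact fun _ _ _ => rfl

lemma Codes.isPartition {X ι : Type*} [MeasurableSpace X] {f : X → ι} {P : Finset (Set X)}
    (h : Codes f P) : IsPartition P := by
  refine ⟨Set.eq_univ_of_forall fun x => ⟨f ⁻¹' {f x}, h.2 _ ⟨x, rfl⟩, rfl⟩, ?_⟩
  intro A hA B hB hAB
  refine Set.disjoint_left.2 fun x hx hy => hAB ?_
  obtain ⟨i, rfl⟩ := h.1 A hA ⟨x, hx⟩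
  obtain ⟨j, rfl⟩ := h.1 B hB ⟨x, hy⟩
  rw [← hx, ← hy]

lemma Codes.measF {X ι : Type*} [MeasurableSpace X] {f : X → ι} {P : Finset (Set X)}
    (h : Codes f P) (hf : FiberMeas f) : MeasF P := by
  intro A hA
  rcases A.eq_empty_or_nonempty with rfl | hne
  · exact MeasurableSet.empty
  · obtain ⟨i, rfl⟩ := h.1 A hA hne
    exact hf i

lemma exists_codes_of_isPartition {X : Type*} [MeasurableSpace X] {P : Finset (Set X)}
    (h : IsPartition P) (hm : MeasF P) :
    ∃ f : X → P, (∀ x, x ∈ (f x : Set X)) ∧ Codes f P ∧ FiberMeas f := by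
  have hc : ∀ x, ∃ A : P, x ∈ (A : Set X) := fun x => by
    have hx : x ∈ ⋃₀ (P : Set (Set X)) := by rw [h.1]; trivial
    obtain ⟨A, hA, hxA⟩ := hx
    exact ⟨⟨A, hA⟩, hxA⟩
  choose f hf using hc
  have hfib : ∀ A : P, f ⁻¹' {A} = A := by
    intro A; ext x
    constructor
    · rintro rfl; exact hf x
    · intro hx
      by_contra hne
      exact Set.disjoint_left.1 (h.2 _ (f x).2 _ A.2 fun he => hne (Subtype.ext he)) (hf x) hx
  refine ⟨f, hf, ⟨fun A hA _ => ⟨⟨A, hA⟩, (hfib ⟨A, hA⟩).symm⟩, fun A _ => ?_⟩, fun A => ?_⟩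
  · rw [hfib]; exact A.2
  · rw [hfib]; exact hm _ A.2

lemma exists_selection {X : Type*} [MeasurableSpace X] {𝒲 : Finset (Set X)}
    (h : IsCover 𝒲) (hm : MeasF 𝒲) :
    ∃ u : X → 𝒲, (∀ x, x ∈ (u x : Set X)) ∧ FiberMeas u := by
  let e := 𝒲.equivFin
  have hne : ∀ x, {k | x ∈ (e.symm k : Set X)}.Nonempty := fun x => by
    have hx : x ∈ ⋃₀ (𝒲 : Set (Set X)) := by rw [h]; trivial
    obtain ⟨A, hA, hxA⟩ := hx
    exact ⟨e ⟨A, hA⟩, by simpa using hxA⟩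
  let r : X → Fin 𝒲.card := fun x => wellFounded_lt.min _ (hne x)
  have hr : ∀ x, x ∈ (e.symm (r x) : Set X) := fun x => wellFounded_lt.min_mem _ (hne x)
  have hr' : ∀ x k, x ∈ (e.symm k : Set X) → ¬ k < r x := fun x k hk =>
    wellFounded_lt.not_lt_min {k | x ∈ (e.symm k : Set X)} hk
  have hfib : FiberMeas r := fun k => by
    have : r ⁻¹' {k} = (e.symm k : Set X) ∩ ⋂ l : {l : Fin 𝒲.card // l < k},
        (e.symm l.1 : Set X)ᶜ := by
      ext x
      simp only [Set.mem_preimage, Set.mem_singleton_iff, Set.mem_inter_iff, Set.mem_iInter,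
        Set.mem_compl_iff, Subtype.forall]
      constructor
      · rintro rfl
        exact ⟨hr x, fun l hl hx => hr' x l hx hl⟩
      · rintro ⟨h1, h2⟩
        refine le_antisymm (not_lt.1 (hr' x k h1)) (not_lt.1 fun h3 => h2 _ h3 (hr x))
    rw [this]
    exact (hm _ (e.symm k).2).inter (MeasurableSet.iInter fun l => (hm _ (e.symm l.1).2).compl)
  exact ⟨fun x => e.symm (r x), hr, hfib.comp _⟩

lemma exists_codes {X ι : Type*} [Fintype ι] (f : X → ι) :
    ∃ P : Finset (Set X), Codes f P := by
  classical
  refine ⟨Finset.univ.image fun i => f ⁻¹' {i}, fun A hA _ => ?_, fun i _ =>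
    Finset.mem_image_of_mem _ (Finset.mem_univ i)⟩
  obtain ⟨i, -, rfl⟩ := Finset.mem_image.1 hA
  exact ⟨i, rfl⟩

lemma Codes.refines {X : Type*} [MeasurableSpace X] {𝒲 P : Finset (Set X)} {u : X → 𝒲}
    (h : Codes u P) (hu : ∀ x, x ∈ (u x : Set X)) (hne : 𝒲.Nonempty) : Refines P 𝒲 := by
  intro A hA
  rcases A.eq_empty_or_nonempty with rfl | hA0
  · exact ⟨_, hne.choose_spec, Set.empty_subset _⟩
  · obtain ⟨i, rfl⟩ := h.1 A hA hA0
    exact ⟨i, i.2, by rintro x rfl; exact hu x⟩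

lemma exists_partition_refines {X : Type*} [MeasurableSpace X] [Nonempty X] {𝒲 : Finset (Set X)}
    (h : IsCover 𝒲) (hm : MeasF 𝒲) :
    ∃ α : Finset (Set X), IsPartition α ∧ MeasF α ∧ Refines α 𝒲 := by
  obtain ⟨u, hu, hum⟩ := exists_selection h hm
  obtain ⟨P, hP⟩ := exists_codes u
  exact ⟨P, hP.isPartition, hP.measF hum,
    hP.refines hu ⟨_, (u (Classical.arbitrary X)).2⟩⟩

end Codes

lemma mem_dynJoin {X : Type*} (T : X → X) (𝒰 : Finset (Set X)) (N : ℕ) (A : Set X) :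
    A ∈ dynJoin T 𝒰 N ↔
      ∃ v : ℕ → Set X, (∀ i < N, v i ∈ 𝒰) ∧ A = {x | ∀ i < N, T^[i] x ∈ v i} := by
  classical
  induction N generalizing A with
  | zero =>
    simp only [dynJoin, Finset.mem_singleton, Nat.not_lt_zero, false_imp_iff, implies_true,
      Set.ofPred_true, true_and]
    exact ⟨fun h => ⟨fun _ => ∅, h⟩, fun ⟨_, h⟩ => h⟩
  | succ N ih =>
    simp only [dynJoin, Paper.join, pre, Finset.mem_image, Finset.mem_product, Prod.exists]
    constructor
    · rintro ⟨B, C, ⟨hB, U, hU, rfl⟩, rfl⟩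
      obtain ⟨v, hv, rfl⟩ := (ih B).1 hB
      refine ⟨fun i => if i = N then U else v i, fun i hi => ?_, ?_⟩
      · by_cases h : i = N
        · simpa [h] using hU
        · simpa [h] using hv i (by omega)
      · ext x
        simp only [Set.mem_inter_iff, Set.mem_ofPred_eq, Set.mem_preimage]
        constructor
        · rintro ⟨h1, h2⟩ i hi
          by_cases h : i = N
          · subst h; simpa using h2
          · simpa [h] using h1 i (by omega)
        · intro h
          refine ⟨fun i hi => ?_, by simpa using h N (Nat.lt_succ_self N)⟩
          simpa [hi.ne] using h i (by omega)
    · rintro ⟨v, hv, rfl⟩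
      refine ⟨{x | ∀ i < N, T^[i] x ∈ v i}, T^[N] ⁻¹' v N,
        ⟨(ih _).2 ⟨v, fun i hi => hv i (by omega), rfl⟩, v N, hv N (Nat.lt_succ_self N), rfl⟩, ?_⟩
      ext x
      simp only [Set.mem_inter_iff, Set.mem_ofPred_eq, Set.mem_preimage, Nat.lt_succ_iff_lt_or_eq]
      constructor
      · rintro ⟨h1, h2⟩ i (hi | rfl)
        exacts [h1 i hi, h2]
      · exact fun h => ⟨fun i hi => h i (Or.inl hi), h N (Or.inr rfl)⟩

lemma isCover_dynJoin {X : Type*} {T : X → X} {𝒰 : Finset (Set X)} (h : IsCover 𝒰) (N : ℕ) :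
    IsCover (dynJoin T 𝒰 N) := by
  refine Set.eq_univ_of_forall fun x => ?_
  have hc : ∀ i, ∃ A ∈ 𝒰, T^[i] x ∈ A := fun i => by
    have hx : T^[i] x ∈ ⋃₀ (𝒰 : Set (Set X)) := by rw [h]; trivial
    simpa using hx
  choose v hv hx using hc
  exact ⟨_, (mem_dynJoin T 𝒰 N _).2 ⟨v, fun i _ => hv i, rfl⟩, fun i _ => hx i⟩

lemma refines_dynJoin {X : Type*} {T : X → X} {α 𝒰 : Finset (Set X)} (h : Refines α 𝒰) (N : ℕ) :
    Refines (dynJoin T α N) (dynJoin T 𝒰 N) := by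
  intro A hA
  obtain ⟨v, hv, rfl⟩ := (mem_dynJoin T α N A).1 hA
  have hc : ∀ i, ∃ B, i < N → B ∈ 𝒰 ∧ v i ⊆ B := fun i => by
    by_cases hi : i < N
    · obtain ⟨B, hB⟩ := h _ (hv i hi)
      exact ⟨B, fun _ => hB⟩
    · exact ⟨∅, fun h => absurd h hi⟩
  choose b hb using hc
  exact ⟨_, (mem_dynJoin T 𝒰 N _).2 ⟨b, fun i hi => (hb i hi).1, rfl⟩,
    fun x hx i hi => (hb i hi).2 (hx i hi)⟩

lemma Codes.dynJoin {X ι : Type*} {f : X → ι} {α : Finset (Set X)} (h : Codes f α) (T : X → X)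
    (N : ℕ) : Codes (itin T f 0 N) (Paper.dynJoin T α N) := by
  constructor
  · rintro A hA ⟨x, hx⟩
    obtain ⟨v, hv, rfl⟩ := (mem_dynJoin T α N A).1 hA
    refine ⟨itin T f 0 N x, ?_⟩
    have hfib : ∀ i < N, v i = f ⁻¹' {f (T^[i] x)} := fun i hi => by
      obtain ⟨k, hk⟩ := h.1 _ (hv i hi) ⟨_, hx i hi⟩
      have := hx i hi
      rw [hk] at this ⊢
      rw [← this]
    ext y
    simp only [Set.mem_ofPred_eq, Set.mem_preimage, Set.mem_singleton_iff, itin, zero_add,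
      funext_iff]
    constructor
    · intro hy k
      have := hy k k.2
      rw [hfib k k.2] at this
      exact this
    · intro hy i hi
      rw [hfib i hi]
      exact hy ⟨i, hi⟩
  · rintro k ⟨x, rfl⟩
    refine (mem_dynJoin T α N _).2 ⟨fun i => f ⁻¹' {f (T^[i] x)}, fun i _ => h.2 _ ⟨_, rfl⟩, ?_⟩
    ext y
    simp only [Set.mem_ofPred_eq, Set.mem_preimage, Set.mem_singleton_iff, itin, zero_add,
      funext_iff]
    exact ⟨fun hy i hi => hy ⟨i, hi⟩, fun hy k => hy k k.2⟩

section DynJoin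

variable {X : Type*} [MeasurableSpace X]

lemma measF_dynJoin {T : X → X} (hT : Measurable T) {𝒰 : Finset (Set X)} (h : MeasF 𝒰) (N : ℕ) :
    MeasF (dynJoin T 𝒰 N) := by
  intro A hA
  obtain ⟨v, hv, rfl⟩ := (mem_dynJoin T 𝒰 N A).1 hA
  have : {x | ∀ i < N, T^[i] x ∈ v i} = ⋂ i : {i // i < N}, T^[i.1] ⁻¹' v i.1 := by
    ext x; simp
  rw [this]
  exact MeasurableSet.iInter fun i => hT.iterate _ (h _ (hv _ i.2))

lemma FiberMeas.itin {ι : Type*} {f : X → ι} (hf : FiberMeas f) {T : X → X} (hT : Measurable T)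
    (s M : ℕ) : FiberMeas (itin T f s M) :=
  FiberMeas.pi fun k => hf.comp_measurable (hT.iterate (s + k))

end DynJoin

section Conditional

variable {X ι κ : Type*} [MeasurableSpace X] [Fintype ι] [Fintype κ]

lemma Codes.entPart_eq {f : X → ι} {α : Finset (Set X)} (h : Codes f α) (μ : Measure X) :
    entPart μ α = ent μ f :=
  h.sum_eq (fun A => negMulLog (μ A).toReal) (by simp)

lemma real_mul_ent_cond (μ : Measure X) [IsFiniteMeasure μ] (f : X → ι) {B : Set X}
    (hB : MeasurableSet B) :
    μ.real B * ent (ProbabilityTheory.cond μ B) f =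
      ∑ i, μ.real (f ⁻¹' {i} ∩ B) * -log (μ.real (f ⁻¹' {i} ∩ B) / μ.real B) := by
  rw [ent, Finset.mul_sum]
  refine Finset.sum_congr rfl fun i _ => ?_
  have h1 : (ProbabilityTheory.cond μ B).real (f ⁻¹' {i}) =
      μ.real (f ⁻¹' {i} ∩ B) / μ.real B := by
    rw [measureReal_def, ProbabilityTheory.cond_apply hB, ENNReal.toReal_mul, ENNReal.toReal_inv,
      Set.inter_comm, div_eq_inv_mul]
    rfl
  rw [h1]
  rcases eq_or_ne (μ.real B) 0 with h | h
  · have : μ.real (f ⁻¹' {i} ∩ B) = 0 := le_antisymm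
      (h ▸ measureReal_mono Set.inter_subset_right) measureReal_nonneg
    simp [h, this]
  · rw [negMulLog]; field_simp

lemma cent_eq_sum_cond (μ : Measure X) [IsFiniteMeasure μ] {f : X → ι} {g : X → κ}
    (hf : FiberMeas f) (hg : FiberMeas g) :
    cent μ f g = ∑ j, μ.real (g ⁻¹' {j}) * ent (ProbabilityTheory.cond μ (g ⁻¹' {j})) f := by
  rw [cent_eq_sum μ hf hg]
  exact Finset.sum_congr rfl fun j _ => (real_mul_ent_cond μ f (hg j)).symm

lemma Codes.entCondPart_eq (μ : Measure X) [IsFiniteMeasure μ] {f : X → ι} {g : X → κ}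
    {α β : Finset (Set X)} (hf : FiberMeas f) (hg : FiberMeas g) (hα : Codes f α)
    (hβ : Codes g β) : entCondPart μ α β = cent μ f g := by
  rw [cent_eq_sum_cond μ hf hg, entCondPart,
    hβ.sum_eq (fun B => (μ B).toReal * entPart (ProbabilityTheory.cond μ B) α) (by simp)]
  exact Finset.sum_congr rfl fun j _ => by rw [hα.entPart_eq]; rfl

lemma Codes.covEntCond_eq (μ : Measure X) {g : X → κ} {𝒲 β : Finset (Set X)} (hβ : Codes g β) :
    covEntCond μ 𝒲 β =
      ∑ j, μ.real (g ⁻¹' {j}) * covEnt (ProbabilityTheory.cond μ (g ⁻¹' {j})) 𝒲 :=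
  hβ.sum_eq (fun B => (μ B).toReal * covEnt (ProbabilityTheory.cond μ B) 𝒲) (by simp)

lemma cond_real_le_one (μ : Measure X) (B A : Set X) :
    (ProbabilityTheory.cond μ B).real A ≤ 1 :=
  ENNReal.toReal_le_of_le_ofReal zero_le_one (by simpa using prob_le_one)

lemma entPart_cond_nonneg (μ : Measure X) (B : Set X) (α : Finset (Set X)) :
    0 ≤ entPart (ProbabilityTheory.cond μ B) α :=
  Finset.sum_nonneg fun _ _ => negMulLog_nonneg ENNReal.toReal_nonneg (cond_real_le_one μ B _)

lemma entCondPart_nonneg (μ : Measure X) (α β : Finset (Set X)) : 0 ≤ entCondPart μ α β :=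
  Finset.sum_nonneg fun _ _ => mul_nonneg ENNReal.toReal_nonneg (entPart_cond_nonneg _ _ _)

lemma bddBelow_covEnt (μ : Measure X) (B : Set X) (𝒲 : Finset (Set X)) :
    BddBelow {h : ℝ | ∃ α : Finset (Set X), IsPartition α ∧ MeasF α ∧ Refines α 𝒲 ∧
      h = entPart (ProbabilityTheory.cond μ B) α} :=
  ⟨0, by rintro _ ⟨α, -, -, -, rfl⟩; exact entPart_cond_nonneg μ B α⟩

lemma covEntCond_nonneg (μ : Measure X) (𝒲 β : Finset (Set X)) : 0 ≤ covEntCond μ 𝒲 β :=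
  Finset.sum_nonneg fun B _ => mul_nonneg ENNReal.toReal_nonneg <| Real.sInf_nonneg <| by
    rintro _ ⟨α, -, -, -, rfl⟩; exact entPart_cond_nonneg μ B α

lemma covEntCond_le_entCondPart (μ : Measure X) {α 𝒲 : Finset (Set X)} (β : Finset (Set X))
    (h1 : IsPartition α) (h2 : MeasF α) (h3 : Refines α 𝒲) :
    covEntCond μ 𝒲 β ≤ entCondPart μ α β :=
  Finset.sum_le_sum fun B _ => mul_le_mul_of_nonneg_left
    (csInf_le (bddBelow_covEnt μ B 𝒲) ⟨α, h1, h2, h3, rfl⟩) ENNReal.toReal_nonneg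

lemma exists_names (μ : Measure X) [IsProbabilityMeasure μ] {g : X → κ} {𝒲 β : Finset (Set X)}
    (h : IsCover 𝒲) (hm : MeasF 𝒲) (hβ : Codes g β) (hg : FiberMeas g) {ε : ℝ} (hε : 0 < ε) :
    ∃ w : X → 𝒲, FiberMeas w ∧ (∀ x, x ∈ (w x : Set X)) ∧
      cent μ w g ≤ covEntCond μ 𝒲 β + ε := by
  have : Nonempty X := nonempty_of_isProbabilityMeasure μ
  let ν : κ → Measure X := fun j => ProbabilityTheory.cond μ (g ⁻¹' {j})
  have hex : ∀ j, ∃ v : X → 𝒲, FiberMeas v ∧ (∀ x, x ∈ (v x : Set X)) ∧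
      ent (ν j) v ≤ covEnt (ν j) 𝒲 + ε := by
    intro j
    obtain ⟨α₀, h1, h2, h3⟩ := exists_partition_refines h hm
    obtain ⟨_, ⟨α, hα, hαm, hαr, rfl⟩, hlt⟩ := exists_lt_of_csInf_lt
      (s := {h : ℝ | ∃ α : Finset (Set X), IsPartition α ∧ MeasF α ∧ Refines α 𝒲 ∧
        h = entPart (ν j) α}) ⟨_, α₀, h1, h2, h3, rfl⟩ (lt_add_of_pos_right _ hε)
    obtain ⟨f, hf, hfc, hfm⟩ := exists_codes_of_isPartition hα hαm
    have hρ : ∀ A : α, ∃ W : 𝒲, (A : Set X) ⊆ W := fun A => by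
      obtain ⟨W, hW, hAW⟩ := hαr A A.2
      exact ⟨⟨W, hW⟩, hAW⟩
    choose ρ hρ using hρ
    refine ⟨fun x => ρ (f x), hfm.comp ρ, fun x => hρ _ (hf x), ?_⟩
    rw [hfc.entPart_eq] at hlt
    exact (ent_comp_le (ν j) hfm ρ).trans hlt.le
  choose v hvm hv hve using hex
  have hw : FiberMeas fun x => v (g x) x := fun k => by
    have : (fun x => v (g x) x) ⁻¹' {k} = ⋃ j, g ⁻¹' {j} ∩ v j ⁻¹' {k} := by
      ext x; simp
    rw [this]
    exact MeasurableSet.iUnion fun j => (hg j).inter (hvm j k)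
  refine ⟨fun x => v (g x) x, hw, fun x => hv _ _, ?_⟩
  rw [cent_eq_sum_cond μ hw hg, hβ.covEntCond_eq]
  have key : ∀ j, μ.real (g ⁻¹' {j}) * ent (ν j) (fun x => v (g x) x) ≤
      μ.real (g ⁻¹' {j}) * covEnt (ν j) 𝒲 + μ.real (g ⁻¹' {j}) * ε := by
    intro j
    have e : ent (ν j) (fun x => v (g x) x) = ent (ν j) (v j) := by
      refine Finset.sum_congr rfl fun k _ => ?_
      congr 1
      rw [measureReal_def, measureReal_def, ProbabilityTheory.cond_apply (hg j),
        ProbabilityTheory.cond_apply (hg j)]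
      congr 3
      ext x
      simp only [Set.mem_inter_iff, Set.mem_preimage, Set.mem_singleton_iff]
      constructor <;> rintro ⟨rfl, h⟩ <;> exact ⟨rfl, h⟩
    rw [e, ← mul_add]
    exact mul_le_mul_of_nonneg_left (hve j) measureReal_nonneg
  refine (Finset.sum_le_sum fun j _ => key j).trans_eq ?_
  rw [Finset.sum_add_distrib, ← Finset.sum_mul, sum_real_fiber μ hg, one_mul]

end Conditional

section Comparison

variable {X : Type*} [MeasurableSpace X]

lemma bddBelow_entCondPart_div (T : X → X) (μ : Measure X) (α β : Finset (Set X)) :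
    BddBelow (Set.range fun N : ℕ =>
      entCondPart μ (dynJoin T α (N + 1)) (dynJoin T β (N + 1)) / (N + 1 : ℝ)) :=
  ⟨0, by rintro _ ⟨N, rfl⟩; exact div_nonneg (entCondPart_nonneg _ _ _) (by positivity)⟩

lemma bddBelow_covEntCond_div (T : X → X) (μ : Measure X) (𝒰 β : Finset (Set X)) :
    BddBelow (Set.range fun N : ℕ =>
      covEntCond μ (dynJoin T 𝒰 (N + 1)) (dynJoin T β (N + 1)) / (N + 1 : ℝ)) :=
  ⟨0, by rintro _ ⟨N, rfl⟩; exact div_nonneg (covEntCond_nonneg _ _ _) (by positivity)⟩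

lemma hPart_nonneg (T : X → X) (μ : Measure X) (α β : Finset (Set X)) : 0 ≤ hPart T μ α β :=
  Real.iInf_nonneg fun _ => div_nonneg (entCondPart_nonneg _ _ _) (by positivity)

lemma bddBelow_hPlus (T : X → X) (μ : Measure X) (𝒰 β : Finset (Set X)) :
    BddBelow {h : ℝ | ∃ α : Finset (Set X),
      IsPartition α ∧ MeasF α ∧ Refines α 𝒰 ∧ h = hPart T μ α β} :=
  ⟨0, by rintro _ ⟨α, -, -, -, rfl⟩; exact hPart_nonneg T μ α β⟩

lemma hMinus_le_hPlus [Nonempty X] {T : X → X} (hT : Measurable T) (μ : Measure X)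
    {𝒰 : Finset (Set X)} (β : Finset (Set X)) (h : IsCover 𝒰) (hm : MeasF 𝒰) :
    hMinus T μ 𝒰 β ≤ hPlus T μ 𝒰 β := by
  obtain ⟨α₀, h1, h2, h3⟩ := exists_partition_refines h hm
  refine le_csInf ⟨_, α₀, h1, h2, h3, rfl⟩ ?_
  rintro _ ⟨α, hα, hαm, hαr, rfl⟩
  refine ciInf_mono (bddBelow_covEntCond_div T μ 𝒰 β) fun N => ?_
  obtain ⟨f, -, hfc, -⟩ := exists_codes_of_isPartition hα hαm
  gcongr
  exact covEntCond_le_entCondPart μ _ (hfc.dynJoin T _).isPartition (measF_dynJoin hT hαm _)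
    (refines_dynJoin hαr _)

end Comparison

section Iterates

lemma iterate_cancel_of_le {X : Type*} {S T : X → X} (h : Function.LeftInverse S T) {a b : ℕ}
    (hab : a ≤ b) (x : X) : S^[b] (T^[a] x) = S^[b - a] x := by
  conv_lhs => rw [← Nat.sub_add_cancel hab, Function.iterate_add_apply, h.iterate a x]

lemma iterate_cancel_of_ge {X : Type*} {S T : X → X} (h : Function.LeftInverse S T) {a b : ℕ}
    (hab : b ≤ a) (x : X) : S^[b] (T^[a] x) = T^[a - b] x := by
  conv_lhs => rw [← Nat.add_sub_cancel' hab, Function.iterate_add_apply, h.iterate b]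

/-- A marker set: visits are at least `N` apart, and every orbit without a period smaller than `N`
visits the set at a time of absolute value smaller than `N`. -/
lemma exists_marker {X : Type*} [TopologicalSpace X] [T2Space X] [SecondCountableTopology X]
    [MeasurableSpace X] [BorelSpace X] (T : X ≃ₜ X) {N : ℕ} (hN : 0 < N) :
    ∃ F : Set X, MeasurableSet F ∧ (∀ x ∈ F, ∀ i, 0 < i → i < N → T^[i] x ∉ F) ∧
      ∀ x, (∀ i, 0 < i → i < N → T^[i] x ≠ x) → ∃ i < N, T^[i] x ∈ F ∨ T.symm^[i] x ∈ F := by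
  classical
  let 𝒪 : Set (Set X) := {O | O ∈ insert ∅ (TopologicalSpace.countableBasis X) ∧
    ∀ x ∈ O, ∀ i, 0 < i → i < N → T^[i] x ∉ O}
  have h𝒪c : 𝒪.Countable :=
    ((TopologicalSpace.countable_countableBasis X).insert ∅).mono fun O hO => hO.1
  obtain ⟨O, hO⟩ := h𝒪c.exists_eq_range ⟨∅, Set.mem_insert _ _, by simp⟩
  have hO𝒪 : ∀ k, O k ∈ 𝒪 := fun k => by rw [hO]; exact ⟨k, rfl⟩
  have hOm : ∀ k, MeasurableSet (O k) := fun k => by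
    rcases (hO𝒪 k).1 with h | h
    · rw [h]; exact MeasurableSet.empty
    · exact (TopologicalSpace.isOpen_of_mem_countableBasis h).measurableSet
  let E : Set X → Set X := fun F => ⋃ i : Fin N, T^[i] ⁻¹' F ∪ T.symm^[i] ⁻¹' F
  let F : ℕ → Set X := fun k => Nat.rec ∅ (fun k F => F ∪ (O k \ E F)) k
  have hF1 : ∀ k, F (k + 1) = F k ∪ (O k \ E (F k)) := fun k => rfl
  have hTm : ∀ i, Measurable (T^[i]) := fun i => T.continuous.measurable.iterate i
  have hSm : ∀ i, Measurable (T.symm^[i]) := fun i => T.symm.continuous.measurable.iterate i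
  have hFm : ∀ k, MeasurableSet (F k) := by
    intro k
    induction k with
    | zero => exact MeasurableSet.empty
    | succ k ih =>
      exact ih.union ((hOm k).diff (MeasurableSet.iUnion fun i => (hTm i ih).union (hSm i ih)))
  have hmono : Monotone F := monotone_nat_of_le_succ fun k => Set.subset_union_left
  have hFd : ∀ k, ∀ x ∈ F k, ∀ i, 0 < i → i < N → T^[i] x ∉ F k := by
    intro k
    induction k with
    | zero => intro x hx; exact absurd hx (Set.notMem_empty x)
    | succ k ih =>
      rw [hF1]
      rintro x (hx | ⟨hx, hxE⟩) i hi hiN (hy | ⟨hy, hyE⟩)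
      · exact ih x hx i hi hiN hy
      · refine hyE (Set.mem_iUnion.2 ⟨⟨i, hiN⟩, Or.inr ?_⟩)
        simpa [T.symm_apply_apply, Function.LeftInverse.iterate T.symm_apply_apply i x] using hx
      · exact hxE (Set.mem_iUnion.2 ⟨⟨i, hiN⟩, Or.inl hy⟩)
      · exact (hO𝒪 k).2 x hx i hi hiN hy
  refine ⟨⋃ k, F k, MeasurableSet.iUnion hFm, ?_, ?_⟩
  · intro x hx i hi hiN hy
    obtain ⟨a, ha⟩ := Set.mem_iUnion.1 hx
    obtain ⟨b, hb⟩ := Set.mem_iUnion.1 hy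
    exact hFd (max a b) x (hmono (le_max_left a b) ha) i hi hiN (hmono (le_max_right a b) hb)
  · intro x hx
    have hV : ∀ i, ∃ V ∈ nhds x, 0 < i → i < N → ∀ y ∈ V, T^[i] y ∉ V := by
      intro i
      by_cases hi : 0 < i ∧ i < N
      · obtain ⟨A, B, hA, hB, hxA, hxB, hAB⟩ := t2_separation (hx i hi.1 hi.2)
        refine ⟨B ∩ T^[i] ⁻¹' A, Filter.inter_mem (hB.mem_nhds hxB)
          ((hA.preimage (T.continuous.iterate i)).mem_nhds hxA), fun _ _ y hy hy' => ?_⟩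
        exact Set.disjoint_left.1 hAB hy.2 hy'.1
      · exact ⟨Set.univ, Filter.univ_mem, fun h1 h2 => absurd ⟨h1, h2⟩ hi⟩
    choose V hVx hV using hV
    have hW : ⋂ i ∈ Finset.range N, V i ∈ nhds x :=
      (Filter.biInter_finset_mem _).2 fun i _ => hVx i
    obtain ⟨U, hU, hxU, hUV⟩ :=
      (TopologicalSpace.isBasis_countableBasis X).mem_nhds_iff.1 hW
    have hU𝒪 : U ∈ 𝒪 := by
      refine ⟨Set.mem_insert_of_mem _ hU, fun y hy i hi hiN hy' => ?_⟩
      have hs : U ⊆ V i := hUV.trans (Set.biInter_subset_of_mem (by simpa using hiN))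
      exact hV i hi hiN y (hs hy) (hs hy')
    rw [hO] at hU𝒪
    obtain ⟨k, rfl⟩ := hU𝒪
    by_cases hxE : x ∈ E (F k)
    · obtain ⟨i, hi⟩ := Set.mem_iUnion.1 hxE
      exact ⟨i, i.2, hi.imp (fun h => Set.mem_iUnion.2 ⟨k, h⟩) fun h => Set.mem_iUnion.2 ⟨k, h⟩⟩
    · exact ⟨0, hN, Or.inl (Set.mem_iUnion.2 ⟨k + 1, Or.inr ⟨hxU, hxE⟩⟩)⟩

lemma mul_real_le_one {X : Type*} [MeasurableSpace X] {μ : Measure X} [IsProbabilityMeasure μ]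
    {T : X → X} (hT : MeasurePreserving T μ μ) {A : Set X} (hA : MeasurableSet A) {N : ℕ}
    (h : ∀ x ∈ A, ∀ i, 0 < i → i < N → T^[i] x ∉ A) : N * μ.real A ≤ 1 := by
  have hd : ∀ i j, j < N → i < j → ∀ x, T^[i] x ∈ A → T^[j] x ∉ A := by
    intro i j hj hij x hx hy
    refine h _ hx (j - i) (by omega) (by omega) ?_
    rwa [← Function.iterate_add_apply, Nat.sub_add_cancel hij.le]
  have e : μ.real (⋃ i ∈ Finset.range N, T^[i] ⁻¹' A) = N * μ.real A := by
    rw [measureReal_biUnion_finset]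
    · rw [Finset.sum_congr rfl fun i _ => show μ.real (T^[i] ⁻¹' A) = μ.real A by
        rw [measureReal_def, (hT.iterate i).measure_preimage hA.nullMeasurableSet,
          measureReal_def]]
      simp
    · intro i hi j hj hij
      refine Set.disjoint_left.2 fun x hx hy => ?_
      rcases hij.lt_or_gt with hlt | hlt
      · exact hd i j (by simpa using hj) hlt x hx hy
      · exact hd j i (by simpa using hi) hlt x hy hx
    · exact fun i _ => (hT.iterate i).measurable hA
  rw [← e]
  exact measureReal_le_one

/-- Cutting the orbits into segments of length `n` between consecutive visits to `F`, with `n`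
choices of the phase of the cuts. -/
lemma exists_cuts {X : Type*} [MeasurableSpace X] {S T : X → X} (hST : Function.LeftInverse S T)
    (hTS : Function.LeftInverse T S) (hS : Measurable S) (hT : Measurable T) {F : Set X}
    (hF : MeasurableSet F) (n : ℕ) :
    ∃ C : ℕ → Set X, (∀ j, MeasurableSet (C j)) ∧ (∀ i j, i ≠ j → Disjoint (C i) (C j)) ∧
      (∀ j, ∀ x ∈ C j, ∀ i, 0 < i → i < n → T^[i] x ∉ C j) ∧
      ∀ j < n, ∀ x, (∃ m, S^[m] x ∈ F) →
        (∃ q < n, S^[q] x ∈ C j) ∨ ∃ t < n, T^[t] x ∈ F ∨ S^[t] x ∈ F := by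
  classical
  let first : ℕ → X → Prop := fun m x => S^[m] x ∈ F ∧ ∀ m' < m, S^[m'] x ∉ F
  have first_unique : ∀ {m m' x}, first m x → first m' x → m = m' := by
    intro m m' x h h'
    rcases lt_trichotomy m m' with hlt | heq | hlt
    · exact absurd h.1 (h'.2 m hlt)
    · exact heq
    · exact absurd h'.1 (h.2 m' hlt)
  refine ⟨fun j => {x | ∃ m, m % n = j ∧ first m x ∧ ∀ t, 0 < t → t < n → T^[t] x ∉ F},
    ?_, ?_, ?_, ?_⟩
  · intro j
    have hSF : ∀ m, Measurable fun x => S^[m] x ∈ F := fun m =>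
      measurableSet_setOfPred.1 (hS.iterate m hF)
    have hTF : ∀ m, Measurable fun x => T^[m] x ∈ F := fun m =>
      measurableSet_setOfPred.1 (hT.iterate m hF)
    refine measurableSet_setOfPred.2 (Measurable.exists fun m => ?_)
    refine measurable_const.and (Measurable.and ?_ ?_)
    · exact (hSF m).and (Measurable.forall fun m' => Measurable.forall fun _ => (hSF m').not)
    · exact Measurable.forall fun t => Measurable.forall fun _ => Measurable.forall fun _ =>
        (hTF t).not
  · intro i j hij
    refine Set.disjoint_left.2 ?_
    rintro x ⟨m, rfl, hm, -⟩ ⟨m', rfl, hm', -⟩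
    exact hij (by rw [first_unique hm hm'])
  · rintro j x ⟨m, rfl, hm, hx⟩ i hi hin ⟨m', hmod, hm', -⟩
    have hmi : first (m + i) (T^[i] x) := by
      refine ⟨?_, fun k hk => ?_⟩
      · rw [iterate_cancel_of_le hST (Nat.le_add_left i m), Nat.add_sub_cancel]
        exact hm.1
      · rcases le_total i k with h | h
        · rw [iterate_cancel_of_le hST h]
          exact hm.2 _ (by omega)
        · rcases h.eq_or_lt with rfl | h
          · rw [iterate_cancel_of_le hST le_rfl]
            exact hm.2 _ (by omega)
          · rw [iterate_cancel_of_ge hST h.le]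
            exact hx _ (by omega) (by omega)
    rw [first_unique hm' hmi] at hmod
    have h1 : i ≡ 0 [MOD n] := Nat.ModEq.add_left_cancel' m (by simpa [Nat.ModEq] using hmod)
    exact absurd (Nat.le_of_dvd hi ((Nat.modEq_zero_iff_dvd).1 h1)) (by omega)
  · intro j hj x hx
    have hm : first (Nat.find hx) x := ⟨Nat.find_spec hx, fun m' h => Nat.find_min hx h⟩
    generalize Nat.find hx = m at hm
    by_cases hmj : m < j
    · exact Or.inr ⟨m, hmj.trans hj, Or.inr hm.1⟩
    by_contra! hcon
    have hq : (m - j) % n < n := Nat.mod_lt _ (by omega)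
    have hqm : (m - j) % n ≤ m - j := Nat.mod_le _ _
    have hdm := Nat.mod_add_div (m - j) n
    set q := (m - j) % n
    refine hcon.1 q hq ⟨m - q, ?_, ⟨?_, fun m' hm' => ?_⟩, fun t ht htn hF => ?_⟩
    · have : m - q = j + n * ((m - j) / n) := by omega
      rw [this, Nat.add_mul_mod_self_left, Nat.mod_eq_of_lt hj]
    · rw [← Function.iterate_add_apply, Nat.sub_add_cancel (by omega)]
      exact hm.1
    · rw [← Function.iterate_add_apply]
      exact hm.2 _ (by omega)
    · rcases le_or_gt t q with h | h
      · rw [iterate_cancel_of_ge hTS h] at hF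
        exact hm.2 _ (by omega) hF
      · rw [iterate_cancel_of_le hTS h.le] at hF
        exact (hcon.2 (t - q) (by omega)).1 hF

end Iterates

section Itineraries

variable {X ι κ : Type*} [MeasurableSpace X] [Fintype ι] [Fintype κ] {μ : Measure X}
  [IsProbabilityMeasure μ] {T : X → X}

lemma cent_nonneg {f : X → ι} {g : X → κ} (hf : FiberMeas f) (hg : FiberMeas g) :
    0 ≤ cent μ f g :=
  sub_nonneg.2 <| ent_le_of_determines μ (hf.prodMk hg) fun _ _ h => (Prod.ext_iff.1 h).2

lemma cent_itin_le (hT : Measurable T) {f : X → ι} {g : X → κ} (hf : FiberMeas f)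
    (hg : FiberMeas g) (s M : ℕ) :
    cent μ (itin T f s M) g ≤ ∑ i ∈ Finset.range M, cent μ (fun x => f (T^[s + i] x)) g := by
  induction M with
  | zero =>
    rw [Finset.sum_range_zero, cent, sub_nonpos]
    exact ent_le_of_determines μ hg fun x y h => Prod.ext (Subsingleton.elim _ _) h
  | succ M ih =>
    rw [Finset.sum_range_succ]
    have hm := hf.comp_measurable (hT.iterate (s + M))
    refine le_trans ?_ ((cent_pair_le μ (hf.itin hT s M) hm hg).trans (by gcongr))
    refine cent_le_of_determines μ ((hf.itin hT s M).prodMk hm) hg fun x y h _ => ?_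
    obtain ⟨h1, h2⟩ := Prod.ext_iff.1 h
    funext k
    rcases Nat.lt_succ_iff_lt_or_eq.1 k.2 with hk | hk
    · exact congrFun h1 ⟨k, hk⟩
    · simpa [itin, hk] using h2

/-- Observing `g` over a window containing `[i, i + n)` is at least as good as observing it
over that segment. -/
lemma cent_shift_le (hT : MeasurePreserving T μ μ) {f : X → ι} {g : X → κ} (hf : FiberMeas f)
    (hg : FiberMeas g) {s M i n : ℕ} (h1 : s ≤ i) (h2 : i + n ≤ s + M) :
    cent μ (fun x => f (T^[i] x)) (itin T g s M) ≤ cent μ f (itin T g 0 n) := by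
  rw [← cent_comp_preserving (hT.iterate i) hf (hg.itin hT.measurable 0 n)]
  refine cent_cond_le_of_determines μ (hf.comp_measurable (hT.measurable.iterate i))
    (hg.itin hT.measurable s M) fun x y h => ?_
  funext k
  have := congrFun h ⟨i - s + k, by omega⟩
  simp only [itin, zero_add, ← Function.iterate_add_apply] at this ⊢
  rwa [show s + (i - s + k) = k + i by omega] at this

end Itineraries

section Coding

/-- `f` observed only on `E`. -/
noncomputable def restr {X ι : Type*} (E : Set X) (f : X → ι) (x : X) : Option ι :=
  letI := Classical.propDecidable (x ∈ E)
  if x ∈ E then some (f x) else none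

lemma restr_of_mem {X ι : Type*} {E : Set X} {f : X → ι} {x : X} (h : x ∈ E) :
    restr E f x = some (f x) := if_pos h

lemma restr_of_notMem {X ι : Type*} {E : Set X} {f : X → ι} {x : X} (h : x ∉ E) :
    restr E f x = none := if_neg h

lemma restr_eq_some {X ι : Type*} {E : Set X} {f : X → ι} {x : X} {i : ι} :
    restr E f x = some i ↔ x ∈ E ∧ f x = i := by
  by_cases h : x ∈ E
  · simp [restr_of_mem h, h]
  · simp [restr_of_notMem h, h]

lemma FiberMeas.restr {X ι : Type*} [MeasurableSpace X] {f : X → ι} (hf : FiberMeas f)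
    {E : Set X} (hE : MeasurableSet E) : FiberMeas (restr E f) := by
  rintro (_ | i)
  · have : CoverEntropy.restr E f ⁻¹' {none} = Eᶜ := by
      ext x
      by_cases h : x ∈ E
      · simp [restr_of_mem h, h]
      · simp [restr_of_notMem h, h]
    rw [this]; exact hE.compl
  · have : CoverEntropy.restr E f ⁻¹' {some i} = E ∩ f ⁻¹' {i} := by
      ext x; simp [restr_eq_some]
    rw [this]; exact hE.inter (hf i)

/-- Decode a label from the block names seen at times `0, -1, …, -(n-1)`, with default `v`. -/
def decode {ι ο : Type*} (d : ι → ℕ → ο) (r : ℕ → Option ι) (v : ο) : ℕ → ο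
  | 0 => v
  | n + 1 => (r n).elim (decode d r v n) fun i => d i n

lemma decode_mem {ι ο : Type*} {d : ι → ℕ → ο} {r : ℕ → Option ι} {v : ο} {P : ο → Prop}
    {n : ℕ} (hr : ∀ q < n, ∀ i, r q = some i → P (d i q)) (hv : P v) : P (decode d r v n) := by
  induction n with
  | zero => exact hv
  | succ n ih =>
    rw [decode]
    cases h : r n with
    | none => exact ih fun q hq => hr q (by omega)
    | some i => exact hr n (Nat.lt_succ_self n) i h

lemma decode_congr {ι ο : Type*} {d : ι → ℕ → ο} {r r' : ℕ → Option ι} {v v' : ο} {n : ℕ}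
    (hr : ∀ q < n, r q = r' q) (hv : (∀ q < n, r q = none) → v = v') :
    decode d r v n = decode d r' v' n := by
  induction n with
  | zero => exact hv (by simp)
  | succ n ih =>
    rw [decode, decode, ← hr n (Nat.lt_succ_self n)]
    cases h : r n with
    | some i => rfl
    | none =>
      refine ih (fun q hq => hr q (by omega)) fun hq => hv fun q hqn => ?_
      rcases Nat.lt_succ_iff_lt_or_eq.1 hqn with h' | rfl
      exacts [hq q h', h]

lemma ent_itin_le_of_periodic {X ι : Type*} [MeasurableSpace X] [Fintype ι] {μ : Measure X}
    [IsProbabilityMeasure μ] {T : X → X} (hT : Measurable T) {f : X → ι} (hf : FiberMeas f)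
    {p : ℕ} (hp : 0 < p) (hfp : ∀ x, f (T^[p] x) = f x) (L : ℕ) :
    ent μ (itin T f 0 L) ≤ ent μ (itin T f 0 p) := by
  have hper : ∀ q x, f ((T^[p])^[q] x) = f x := by
    intro q
    induction q with
    | zero => exact fun x => rfl
    | succ q ih => intro x; rw [Function.iterate_succ_apply, ih, hfp]
  have hmod : ∀ k x, f (T^[k] x) = f (T^[k % p] x) := by
    intro k x
    conv_lhs => rw [← Nat.div_add_mod k p, Function.iterate_add_apply, Function.iterate_mul, hper]
  refine ent_le_of_determines μ (hf.itin hT 0 p) fun x y h => ?_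
  funext k
  have := congrFun h ⟨k % p, Nat.mod_lt _ hp⟩
  simp only [itin, zero_add] at this ⊢
  rw [hmod k x, hmod k y, this]

lemma le_of_forall_le_add_div {a A γ : ℝ} (h : ∀ L : ℕ, a ≤ γ + A * (1 / (L + 1 : ℝ))) :
    a ≤ γ := by
  have ht : Tendsto (fun L : ℕ => γ + A * (1 / (L + 1 : ℝ))) atTop (nhds (γ + A * 0)) :=
    tendsto_const_nhds.add (tendsto_one_div_add_atTop_nhds_zero_nat.const_mul A)
  simpa using ge_of_tendsto' ht h

lemma hPlus_le_cent {X ι κ : Type*} [MeasurableSpace X] [Fintype ι] [Fintype κ] {μ : Measure X}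
    [IsProbabilityMeasure μ] {S T : X → X} (hST : Function.LeftInverse S T)
    (hTS : Function.LeftInverse T S) (hS : Measurable S) (hT : MeasurePreserving T μ μ)
    {𝒰 β : Finset (Set X)} {g : X → κ} (hg : FiberMeas g) (hβ : Codes g β) {u : X → 𝒰}
    (hum : FiberMeas u) (hu : ∀ x, x ∈ (u x : Set X)) {w : X → ι} (hw : FiberMeas w) {n : ℕ}
    (d : ι → ℕ → 𝒰) (hd : ∀ x, ∀ i < n, T^[i] x ∈ (d (w x) i : Set X)) {C D Z : Set X}
    (hC : MeasurableSet C) (hD : MeasurableSet D) (hZ : MeasurableSet Z) {p : ℕ} (hp : 0 < p)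
    (hZp : ∀ x ∈ Z, T^[p] x = x) (hcov : ∀ x, x ∈ Z ∨ x ∈ D ∨ ∃ q < n, S^[q] x ∈ C) :
    hPlus T μ 𝒰 β ≤ cent μ (fun x => (restr C w x, restr D u x)) (itin T g 0 n) := by
  have : Nonempty X := nonempty_of_isProbabilityMeasure μ
  have hR : FiberMeas (restr C w) := hw.restr hC
  have hS1 : FiberMeas (restr D u) := hum.restr hD
  have hS2 : FiberMeas (restr Z u) := hum.restr hZ
  let G : X → Option ι × Option 𝒰 := fun x => (restr C w x, restr D u x)
  have hG : FiberMeas G := hR.prodMk hS1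
  let a : X → 𝒰 := fun x => decode d (fun q => restr C w (S^[q] x)) (u x) n
  have ham : FiberMeas a := by
    obtain ⟨φ, hφ⟩ := exists_comp_eq (f := a) (f' := fun x => (itin S (restr C w) 0 n x, u x)) <| by
      intro x y h
      obtain ⟨h1, h2⟩ := Prod.ext_iff.1 h
      refine decode_congr (fun q hq => ?_) fun _ => h2
      simpa [itin] using congrFun h1 ⟨q, hq⟩
    rw [hφ]
    exact ((hR.itin hS 0 n).prodMk hum).comp φ
  have ha : ∀ x, x ∈ (a x : Set X) := by
    intro x
    refine decode_mem (P := fun U : 𝒰 => x ∈ (U : Set X)) (fun q hq i hi => ?_) (hu x)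
    obtain ⟨-, rfl⟩ := restr_eq_some.1 hi
    simpa [hTS.iterate q x] using hd (S^[q] x) q hq
  have hZper : ∀ x, restr Z u (T^[p] x) = restr Z u x := by
    intro x
    by_cases hx : x ∈ Z
    · rw [hZp x hx]
    · have hx' : T^[p] x ∉ Z := fun h => hx <| by
        have h2 : T^[p] x = x := (hST.iterate p).injective (hZp _ h)
        rwa [h2] at h
      rw [restr_of_notMem hx, restr_of_notMem hx']
  obtain ⟨α, hα⟩ := exists_codes a
  refine (csInf_le (bddBelow_hPlus T μ 𝒰 β) ⟨α, hα.isPartition, hα.measF ham,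
    hα.refines ha ⟨_, (u (Classical.arbitrary X)).2⟩, rfl⟩).trans ?_
  set γ := cent μ G (itin T g 0 n)
  have hγ : 0 ≤ γ := cent_nonneg hG (hg.itin hT.measurable 0 n)
  set K := ent μ G
  set K₂ := ent μ (itin T (restr Z u) 0 p)
  have hTm := hT.measurable
  have hK : 0 ≤ K := (cent_nonneg hG hg).trans (cent_le_ent μ hG hg)
  have hK₂ : 0 ≤ K₂ :=
    (cent_nonneg (hS2.itin hTm 0 p) hg).trans (cent_le_ent μ (hS2.itin hTm 0 p) hg)
  have main : ∀ L, cent μ (itin T a 0 (n + L)) (itin T g 0 (n + L)) ≤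
      L * γ + (2 * n * K + K₂) := by
    intro L
    have e : cent μ (itin T a 0 (n + L)) (itin T g 0 (n + L)) =
        cent μ (itin T a n (n + L)) (itin T g n (n + L)) := by
      rw [← cent_comp_preserving (hT.iterate n) (ham.itin hTm 0 (n + L))
        (hg.itin hTm 0 (n + L))]
      congr 1 <;>
      · funext x k
        simp only [itin, ← Function.iterate_add_apply]
        congr 2
        omega
    have hgm := hg.itin hTm n (n + L)
    have hGm := hG.itin hTm 0 (n + L + n)
    have hS2m := hS2.itin hTm 0 (n + L + n)
    have step1 : cent μ (itin T a n (n + L)) (itin T g n (n + L)) ≤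
        cent μ (fun x => (itin T G 0 (n + L + n) x, itin T (restr Z u) 0 (n + L + n) x))
          (itin T g n (n + L)) := by
      refine cent_le_of_determines μ (hGm.prodMk hS2m) hgm fun x y h _ => ?_
      obtain ⟨h1, h2⟩ := Prod.ext_iff.1 h
      have hGxy : ∀ k < n + L + n, G (T^[k] x) = G (T^[k] y) := fun k hk => by
        simpa only [itin, zero_add] using congrFun h1 ⟨k, hk⟩
      have hZxy : ∀ k < n + L + n, restr Z u (T^[k] x) = restr Z u (T^[k] y) := fun k hk => by
        simpa only [itin, zero_add] using congrFun h2 ⟨k, hk⟩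
      funext k
      have hk := k.2
      refine decode_congr (fun q hq => ?_) fun hnone => ?_
      · rw [iterate_cancel_of_ge hST (by omega), iterate_cancel_of_ge hST (by omega)]
        exact (Prod.ext_iff.1 (hGxy _ (by omega))).1
      · rcases hcov (T^[n + k] x) with hx | hx | ⟨q, hq, hx⟩
        · have h3 := hZxy (n + k) (by omega)
          rw [restr_of_mem hx] at h3
          exact (restr_eq_some.1 h3.symm).2.symm
        · have h3 := (Prod.ext_iff.1 (hGxy (n + k) (by omega))).2
          change restr D u _ = restr D u _ at h3
          rw [restr_of_mem hx] at h3
          exact (restr_eq_some.1 h3.symm).2.symm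
        · have h3 := hnone q hq
          rw [restr_of_mem hx] at h3
          exact absurd h3 (by simp)
    have step2 : cent μ (itin T (restr Z u) 0 (n + L + n)) (itin T g n (n + L)) ≤ K₂ :=
      (cent_le_ent μ hS2m hgm).trans (ent_itin_le_of_periodic hTm hS2 hp hZper _)
    have hterm : ∀ i, cent μ (fun x => G (T^[0 + i] x)) (itin T g n (n + L)) ≤ K := fun i =>
      (cent_le_ent μ (hG.comp_measurable (hTm.iterate _)) hgm).trans_eq
        (ent_comp_preserving (hT.iterate _) hG)
    have step3 : cent μ (itin T G 0 (n + L + n)) (itin T g n (n + L)) ≤ L * γ + 2 * n * K := by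
      refine (cent_itin_le hTm hG hgm 0 _).trans ?_
      rw [Finset.sum_range_add, Finset.sum_range_add]
      have s1 := Finset.sum_le_card_nsmul (Finset.range n)
        (fun i => cent μ (fun x => G (T^[0 + i] x)) (itin T g n (n + L))) K fun i _ => hterm i
      have s2 := Finset.sum_le_card_nsmul (Finset.range L)
        (fun i => cent μ (fun x => G (T^[0 + (n + i)] x)) (itin T g n (n + L))) γ fun i hi => by
          have hi := Finset.mem_range.1 hi
          exact cent_shift_le hT hG hg (by omega) (by omega)
      have s3 := Finset.sum_le_card_nsmul (Finset.range n)
        (fun i => cent μ (fun x => G (T^[0 + (n + L + i)] x)) (itin T g n (n + L))) K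
        fun i _ => hterm _
      simp only [Finset.card_range, nsmul_eq_mul] at s1 s2 s3
      linarith
    rw [e]
    refine step1.trans ((cent_pair_le μ hGm hS2m hgm).trans ?_)
    linarith
  refine le_of_forall_le_add_div (A := 2 * n * K + K₂) fun L => ?_
  refine (ciInf_le (bddBelow_entCondPart_div T μ α β) (n + L)).trans ?_
  rw [Codes.entCondPart_eq μ (ham.itin hTm 0 _) (hg.itin hTm 0 _) (hα.dynJoin T _)
    (hβ.dynJoin T _), add_assoc n L 1, div_le_iff₀ (by positivity)]
  refine (main (L + 1)).trans ?_
  have hA : 0 ≤ 2 * n * K + K₂ := by positivity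
  have h1 : 1 ≤ 1 / (L + 1 : ℝ) * ((n + L : ℕ) + 1 : ℝ) := by
    rw [one_div, inv_mul_eq_div, one_le_div (by positivity)]
    push_cast
    linarith [(Nat.cast_nonneg n : (0 : ℝ) ≤ n)]
  have h2 : ((L + 1 : ℕ) : ℝ) * γ ≤ γ * ((n + L : ℕ) + 1 : ℝ) := by
    rw [mul_comm]
    refine mul_le_mul_of_nonneg_left ?_ hγ
    push_cast
    linarith [(Nat.cast_nonneg n : (0 : ℝ) ≤ n)]
  have h3 := mul_le_mul_of_nonneg_left h1 hA
  rw [add_mul]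
  linarith

end Coding

section Assembly

lemma exists_small_parameter {ε : ℝ} (hε : 0 < ε) :
    ∃ δ : ℝ, 0 < δ ∧ δ < 1 ∧ ∀ τ, 0 < τ → τ < δ → τ * -log τ < ε ∧ -log (1 - τ) < ε := by
  have h1 : ContinuousAt negMulLog 0 := continuous_negMulLog.continuousAt
  have h2 : ContinuousAt (fun τ : ℝ => -log (1 - τ)) 0 := by
    refine (ContinuousAt.log (by fun_prop) (by norm_num)).neg
  have e1 : ∀ᶠ τ in nhds (0 : ℝ), negMulLog τ < ε :=
    h1.eventually_lt continuousAt_const (by simpa using hε)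
  have e2 : ∀ᶠ τ in nhds (0 : ℝ), -log (1 - τ) < ε :=
    h2.eventually_lt continuousAt_const (by simpa using hε)
  obtain ⟨δ, hδ, h⟩ := Metric.eventually_nhds_iff.1 (e1.and e2)
  refine ⟨min δ (1 / 2), by positivity, (min_le_right _ _).trans_lt (by norm_num),
    fun τ h0 hτ => ?_⟩
  have h3 := h (y := τ) (by
    rw [Real.dist_eq, sub_zero, abs_of_pos h0]; exact hτ.trans_le (min_le_left _ _))
  refine ⟨?_, h3.2⟩
  have h4 := h3.1
  rw [negMulLog] at h4
  linarith

/-- Concatenating block names: long blocks have names of conditional entropy rate at most that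
of the short ones. -/
lemma exists_long_names {X ι κ ο : Type*} [MeasurableSpace X] [Fintype ι] [Fintype κ]
    {μ : Measure X} [IsProbabilityMeasure μ] {T : X → X} (hT : MeasurePreserving T μ μ)
    {g : X → κ} (hg : FiberMeas g) {w : X → ι} (hw : FiberMeas w) {m : ℕ} (d : ι → ℕ → ο)
    (P : X → ο → Prop) (hd : ∀ x, ∀ i < m, P (T^[i] x) (d (w x) i)) (k : ℕ) :
    ∃ (v : X → Fin k → ι) (d' : (Fin k → ι) → ℕ → ο), FiberMeas v ∧
      (∀ x, ∀ i < k * m, P (T^[i] x) (d' (v x) i)) ∧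
      cent μ v (itin T g 0 (k * m)) ≤ k * cent μ w (itin T g 0 m) := by
  have hTm := hT.measurable
  have : Nonempty X := nonempty_of_isProbabilityMeasure μ
  refine ⟨itin T^[m] w 0 k, fun r i => if h : i / m < k then d (r ⟨i / m, h⟩) (i % m) else
    d (w (Classical.arbitrary X)) 0, hw.itin (hTm.iterate m) 0 k, ?_, ?_⟩
  · intro x i hi
    have hm : 0 < m := Nat.pos_of_ne_zero (by rintro rfl; simp at hi)
    have hik : i / m < k := Nat.div_lt_of_lt_mul (by rwa [mul_comm])
    have := hd ((T^[m])^[i / m] x) (i % m) (Nat.mod_lt _ hm)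
    rw [← Function.iterate_mul, ← Function.iterate_add_apply, Nat.mod_add_div] at this
    simpa [hik, itin, ← Function.iterate_mul] using this
  · refine (cent_itin_le (hTm.iterate m) hw (hg.itin hTm 0 _) 0 k).trans ?_
    refine (Finset.sum_le_card_nsmul _ _ (cent μ w (itin T g 0 m)) fun i hi => ?_).trans_eq ?_
    · have hi := Finset.mem_range.1 hi
      simp only [zero_add, ← Function.iterate_mul]
      refine cent_shift_le hT hw hg (Nat.zero_le _) ?_
      have : m * i + m = (i + 1) * m := by ring
      rw [this, zero_add]
      exact Nat.mul_le_mul_right m hi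
    · simp

/-- Some phase of the cuts carries at most its share of the information of the block names. -/
lemma exists_good_phase {X ι κ : Type*} [MeasurableSpace X] [Fintype ι] [Fintype κ]
    {μ : Measure X} [IsProbabilityMeasure μ] {w : X → ι} {b : X → κ} (hw : FiberMeas w)
    (hb : FiberMeas b) {C : ℕ → Set X} (hC : ∀ j, MeasurableSet (C j))
    (hCd : ∀ i j, i ≠ j → Disjoint (C i) (C j)) {n : ℕ} (hn : 0 < n) :
    ∃ j < n, n * ∑ l, ∑ i, μ.real (C j ∩ (w ⁻¹' {i} ∩ b ⁻¹' {l})) *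
      -log (μ.real (w ⁻¹' {i} ∩ b ⁻¹' {l}) / μ.real (b ⁻¹' {l})) ≤ cent μ w b := by
  by_contra! hcon
  let J : ℕ → ℝ := fun j => ∑ l, ∑ i, μ.real (C j ∩ (w ⁻¹' {i} ∩ b ⁻¹' {l})) *
      -log (μ.real (w ⁻¹' {i} ∩ b ⁻¹' {l}) / μ.real (b ⁻¹' {l}))
  have h1 : ∑ j ∈ Finset.range n, cent μ w b < ∑ j ∈ Finset.range n, n * J j :=
    Finset.sum_lt_sum_of_nonempty (by simpa using hn.ne') fun j hj =>
      hcon j (Finset.mem_range.1 hj)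
  have h2 : ∑ j ∈ Finset.range n, J j ≤ cent μ w b := by
    rw [cent_eq_sum μ hw hb, Finset.sum_comm]
    refine Finset.sum_le_sum fun l _ => ?_
    rw [Finset.sum_comm]
    refine Finset.sum_le_sum fun i _ => ?_
    rw [← Finset.sum_mul]
    refine mul_le_mul_of_nonneg_right ?_ ?_
    · rw [← measureReal_biUnion_finset]
      · exact measureReal_mono (Set.iUnion₂_subset fun j _ => Set.inter_subset_right)
      · intro j _ j' _ hj
        exact (hCd j j' hj).mono Set.inter_subset_left Set.inter_subset_left
      · exact fun j _ => (hC j).inter ((hw i).inter (hb l))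
    · exact neg_nonneg.2 (log_nonpos (by positivity)
        (div_le_one_of_le₀ (measureReal_mono Set.inter_subset_right) measureReal_nonneg))
  rw [← Finset.mul_sum, Finset.sum_const, Finset.card_range, nsmul_eq_mul] at h1
  have hn' : (0 : ℝ) < n := by exact_mod_cast hn
  exact absurd (lt_of_mul_lt_mul_left h1 hn'.le) (not_lt.2 h2)

lemma hPlus_le_hMinus {X : Type*} [TopologicalSpace X] [T2Space X] [SecondCountableTopology X]
    [MeasurableSpace X] [BorelSpace X] (T : X ≃ₜ X) {𝒰 β : Finset (Set X)} (h𝒰 : IsCover 𝒰)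
    (h𝒰m : MeasF 𝒰) (hβ : IsPartition β) (hβm : MeasF β) (μ : Measure X)
    [IsProbabilityMeasure μ] (hT : MeasurePreserving T μ μ) :
    hPlus T μ 𝒰 β ≤ hMinus T μ 𝒰 β := by
  have : Nonempty X := nonempty_of_isProbabilityMeasure μ
  have hST : Function.LeftInverse T.symm T := T.symm_apply_apply
  have hTS : Function.LeftInverse T T.symm := T.apply_symm_apply
  have hTm : Measurable T := hT.measurable
  have hS : MeasurePreserving T.symm μ μ := MeasurePreserving.symm T.toMeasurableEquiv hT
  obtain ⟨u, hu, hum⟩ := exists_selection h𝒰 h𝒰m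
  obtain ⟨g, -, hgβ, hg⟩ := exists_codes_of_isPartition hβ hβm
  refine le_of_forall_pos_le_add fun ε hε => ?_
  obtain ⟨ε, rfl⟩ : ∃ ε', ε = 6 * ε' := ⟨ε / 6, by ring⟩
  replace hε : 0 < ε := by linarith
  obtain ⟨m₀, hm₀⟩ := exists_lt_of_ciInf_lt
    (lt_add_of_pos_right (hMinus T μ 𝒰 β) hε)
  have hm0 : (0 : ℝ) < m₀ + 1 := by positivity
  rw [div_lt_iff₀ hm0] at hm₀
  obtain ⟨w₀, hw₀, hw₀x, hw₀e⟩ := exists_names μ (isCover_dynJoin (T := T) h𝒰 (m₀ + 1))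
    (measF_dynJoin hTm h𝒰m (m₀ + 1)) (hgβ.dynJoin T (m₀ + 1)) (hg.itin hTm 0 (m₀ + 1))
    (mul_pos hε hm0)
  have hdec : ∀ W : dynJoin T 𝒰 (m₀ + 1), ∃ d : ℕ → 𝒰, ∀ x ∈ (W : Set X), ∀ i < m₀ + 1,
      T^[i] x ∈ (d i : Set X) := by
    intro W
    obtain ⟨v, hv, hW⟩ := (mem_dynJoin T 𝒰 (m₀ + 1) W).1 W.2
    refine ⟨fun i => if h : i < m₀ + 1 then ⟨v i, hv i h⟩ else u (Classical.arbitrary X),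
      fun x hx i hi => ?_⟩
    rw [hW] at hx
    simpa [hi] using hx i hi
  choose d₀ hd₀ using hdec
  obtain ⟨δ, hδ, hδ1, hsmall⟩ := exists_small_parameter hε
  obtain ⟨k₀, hk₀⟩ := exists_nat_one_div_lt hδ
  obtain ⟨w, d, hw, hd, hwe⟩ := exists_long_names hT hg hw₀ d₀ (fun x U => x ∈ (U : Set X))
    (fun x i hi => hd₀ _ x (hw₀x x) i hi) (k₀ + 1)
  set n := (k₀ + 1) * (m₀ + 1) with hn
  have hn0 : 0 < n := by positivity
  have hn0' : (0 : ℝ) < n := by exact_mod_cast hn0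
  have hwn : cent μ w (itin T g 0 n) ≤ n * (hMinus T μ 𝒰 β + 2 * ε) := by
    refine hwe.trans ?_
    rw [hn]
    push_cast
    rw [mul_assoc]
    gcongr
    linarith
  let τ : ℝ := 1 / n
  have hτ0 : 0 < τ := by positivity
  have hτδ : τ < δ := by
    refine lt_of_le_of_lt ?_ hk₀
    refine one_div_le_one_div_of_le (by positivity) ?_
    rw [hn]; push_cast
    nlinarith [(Nat.cast_nonneg k₀ : (0 : ℝ) ≤ k₀), (Nat.cast_nonneg m₀ : (0 : ℝ) ≤ m₀)]
  have hτ1 : τ < 1 := hτδ.trans hδ1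
  obtain ⟨hs1, hs2⟩ := hsmall τ hτ0 hτδ
  have hlogτ : 0 ≤ -log τ := neg_nonneg.2 (log_nonpos hτ0.le hτ1.le)
  have hcard : (1 : ℝ) ≤ Fintype.card 𝒰 := by
    have : Nonempty 𝒰 := ⟨u (Classical.arbitrary X)⟩
    exact_mod_cast Fintype.card_pos
  have hlogc : 0 ≤ log (Fintype.card 𝒰) := log_nonneg hcard
  obtain ⟨N, hN⟩ := exists_nat_gt (2 * n * (log (Fintype.card 𝒰) + -log τ) / ε)
  have hN0' : (0 : ℝ) < N := lt_of_le_of_lt (by positivity) hN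
  have hN0 : 0 < N := by exact_mod_cast hN0'
  obtain ⟨F, hF, hFd, hFcov⟩ := exists_marker T hN0
  obtain ⟨C, hC, hCd, hCn, hCcov⟩ := exists_cuts hST hTS hS.measurable hTm hF n
  obtain ⟨j, hj, hjle⟩ := exists_good_phase (μ := μ) hw (hg.itin hTm 0 n) hC hCd hn0
  let Z : Set X := ⋃ i : {i // 0 < i ∧ i < N}, {x | T^[i] x = x}
  have hZ : MeasurableSet Z := MeasurableSet.iUnion fun i =>
    (isClosed_eq (T.continuous.iterate _) continuous_id).measurableSet
  have hZp : ∀ x ∈ Z, T^[N.factorial] x = x := by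
    intro x hx
    obtain ⟨⟨i, hi, hiN⟩, hx⟩ := Set.mem_iUnion.1 hx
    exact Function.IsPeriodicPt.trans_dvd (show Function.IsPeriodicPt T i x from hx)
      (Nat.dvd_factorial hi hiN.le)
  let D : Set X := ⋃ t ∈ Finset.range n, T^[t] ⁻¹' F ∪ T.symm^[t] ⁻¹' F
  have hD : MeasurableSet D := Finset.measurableSet_biUnion _ fun t _ =>
    (hTm.iterate t hF).union (hS.measurable.iterate t hF)
  have hcov : ∀ x, x ∈ Z ∨ x ∈ D ∨ ∃ q < n, T.symm^[q] x ∈ C j := by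
    intro x
    by_cases hx : x ∈ Z
    · exact Or.inl hx
    refine Or.inr ?_
    have hvisit : ∃ l, T.symm^[l] x ∈ F := by
      have hx' : ∀ i, 0 < i → i < N → T^[i] (T.symm^[N] x) ≠ T.symm^[N] x := by
        intro i hi hiN h
        refine hx (Set.mem_iUnion.2 ⟨⟨i, hi, hiN⟩, ?_⟩)
        have := congrArg T^[N] h
        rwa [← Function.iterate_add_apply, add_comm, Function.iterate_add_apply,
          hTS.iterate N x] at this
      obtain ⟨i, hi, h | h⟩ := hFcov _ hx'
      · rw [iterate_cancel_of_ge hTS hi.le] at h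
        exact ⟨_, h⟩
      · rw [← Function.iterate_add_apply] at h
        exact ⟨_, h⟩
    rcases hCcov j hj x hvisit with h | ⟨t, ht, h⟩
    · exact Or.inr h
    · exact Or.inl (Set.mem_biUnion (Finset.mem_coe.2 (Finset.mem_range.2 ht)) h)
  have hμF : N * μ.real F ≤ 1 := mul_real_le_one hT hF hFd
  have hμC : μ.real (C j) ≤ τ := by
    have := mul_real_le_one hT (hC j) (hCn j)
    rw [le_div_iff₀ hn0']; linarith
  have hμD : μ.real D ≤ 2 * n * μ.real F := by
    refine (measureReal_biUnion_finset_le _ _).trans ?_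
    refine (Finset.sum_le_card_nsmul _ _ (2 * μ.real F) fun t _ => ?_).trans_eq ?_
    · refine (measureReal_union_le _ _).trans_eq ?_
      rw [measureReal_def, measureReal_def,
        (hT.iterate t).measure_preimage hF.nullMeasurableSet,
        (hS.iterate t).measure_preimage hF.nullMeasurableSet, measureReal_def]
      ring
    · rw [Finset.card_range, nsmul_eq_mul]; ring
  have hDε : μ.real D * (log (Fintype.card 𝒰) + -log τ) ≤ ε := by
    rw [div_lt_iff₀ hε] at hN
    have h1 := mul_le_mul_of_nonneg_right hμD (add_nonneg hlogc hlogτ)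
    have h2 : N * (μ.real D * (log (Fintype.card 𝒰) + -log τ)) ≤ N * ε := by
      have h3 := mul_le_mul_of_nonneg_left h1 hN0'.le
      have h4 := mul_le_mul_of_nonneg_right hμF
        (by positivity : 0 ≤ 2 * n * (log (Fintype.card 𝒰) + -log τ))
      nlinarith
    exact le_of_mul_le_mul_left h2 hN0'
  refine (hPlus_le_cent hST hTS hS.measurable hT hg hgβ hum hu hw d hd (hC j) hD hZ
    N.factorial_pos hZp hcov).trans ?_
  have hbm := hg.itin hTm 0 n
  have hRm : FiberMeas (restr (C j) w) := hw.restr (hC j)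
  have hDm : FiberMeas (restr D u) := hum.restr hD
  refine (cent_pair_le μ hRm hDm hbm).trans ?_
  have hR : cent μ (restr (C j) w) (itin T g 0 n) ≤ hMinus T μ 𝒰 β + 2 * ε + ε + ε := by
    refine (cent_partial_le μ hRm hbm (hC j) (fun x => restr_of_mem)
      (fun x => restr_of_notMem)
      (fun i l => μ.real (w ⁻¹' {i} ∩ itin T g 0 n ⁻¹' {l}) / μ.real (itin T g 0 n ⁻¹' {l}))
      (fun i l => by positivity) (fun l => ?_) (fun i l h => ?_) hτ0 hτ1).trans ?_
    · rw [← Finset.sum_div, sum_real_inter' μ hw (hbm l)]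
      exact div_self_le_one _
    · exact div_pos h (h.trans_le (measureReal_mono Set.inter_subset_right))
    · have h1 := le_of_mul_le_mul_left (hjle.trans hwn) hn0'
      have h2 := mul_le_mul_of_nonneg_right hμC hlogτ
      linarith
  have hD' : cent μ (restr D u) (itin T g 0 n) ≤ ε + ε := by
    refine (cent_partial_le μ hDm hbm hD (fun x => restr_of_mem) (fun x => restr_of_notMem)
      (fun _ _ => 1 / Fintype.card 𝒰) (fun _ _ => by positivity) (fun _ => ?_)
      (fun _ _ _ => by positivity) hτ0 hτ1).trans ?_
    · rw [Finset.sum_const, Finset.card_univ, nsmul_eq_mul, mul_one_div]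
      exact div_self_le_one _
    · have h1 : ∑ l, ∑ i, μ.real (D ∩ (u ⁻¹' {i} ∩ itin T g 0 n ⁻¹' {l})) = μ.real D := by
        rw [← sum_real_inter μ hbm hD]
        refine Finset.sum_congr rfl fun l _ => ?_
        rw [← sum_real_inter μ hum (hD.inter (hbm l))]
        refine Finset.sum_congr rfl fun i _ => ?_
        rw [Set.inter_comm (u ⁻¹' {i}), Set.inter_assoc]
      simp_rw [← Finset.sum_mul]
      rw [h1, one_div, log_inv, neg_neg]
      linarith
  linarith

end Assembly

end CoverEntropy


/-- For every TDS `(X,T)`, every (not necessarily open) cover `𝒰` of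
Borel sets, every finite Borel partition `β` and every `μ ∈ M_T(X)`:
`h⁺_μ(𝒰|β,T) = h⁻_μ(𝒰|β,T)`. -/
theorem statement19 {X : Type*} [MetricSpace X] [CompactSpace X]
    [MeasurableSpace X] [BorelSpace X] (T : X ≃ₜ X)
    (𝒰 β : Finset (Set X)) (h𝒰 : IsCover 𝒰) (h𝒰m : MeasF 𝒰)
    (hβ : IsPartition β) (hβm : MeasF β)
    (μ : MeasureTheory.Measure X) [MeasureTheory.IsProbabilityMeasure μ]
    (hT : MeasureTheory.MeasurePreserving (⇑T) μ μ) :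
    hPlus (⇑T) μ 𝒰 β = hMinus (⇑T) μ 𝒰 β := by
  have : Nonempty X := nonempty_of_isProbabilityMeasure μ
  exact le_antisymm (CoverEntropy.hPlus_le_hMinus T h𝒰 h𝒰m hβ hβm μ hT)
    (CoverEntropy.hMinus_le_hPlus hT.measurable μ β h𝒰 h𝒰m)
end
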